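/- arXiv:2602.01336 — 6 statements merged into one kernel-verified Lean document; each statement's English description precedes it below -/
import Mathlib

section
/- Let d ≥ 1 and let the additive group ℤ^d act on a set X (write g + x for the action of g ∈ ℤ^d on x ∈ X). Let K ⊆ X satisfy X = ⋃_{g ∈ ℤ^d} (g + K), and let s ≥ 1 be an integer such that (h + K) ∩ K = ∅ for every h ∈ ℤ^d with ‖h‖_∞ ≥ s, where ‖h‖_∞ = max_i |h_i|. Define K̃ := ⋃ {g + K : g ∈ ℤ^d, 0 ≤ g_i ≤ s − 1 for all i = 1,…,d}. Then: (i) X = ⋃_{h ∈ ℤ^d} (s·h + K̃); and (ii) for every h ∈ ℤ^d, if (s·h + K̃) ∩ K̃ ≠ ∅ then ‖h‖_∞ ≤ 1. -/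
/-- Rescaling the ℤ^d action by s and enlarging the fundamental
domain K to K̃ gives a fundamental domain whose translates intersect only for
shifts of sup-norm at most 1. -/
theorem rescaled_fundamental_domain
    (d : ℕ) (hd : 1 ≤ d) (X : Type*) [AddAction (Fin d → ℤ) X]
    (K : Set X) (s : ℕ) (hs : 1 ≤ s)
    (hcover : (⋃ g : Fin d → ℤ, (fun x => g +ᵥ x) '' K) = Set.univ)
    (hsep : ∀ h : Fin d → ℤ, (∃ i, (s : ℤ) ≤ |h i|) →
      (fun x => h +ᵥ x) '' K ∩ K = ∅)
    (Ktilde : Set X)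
    (hKtilde : Ktilde =
      ⋃ g ∈ {g : Fin d → ℤ | ∀ i, 0 ≤ g i ∧ g i ≤ (s : ℤ) - 1},
        (fun x => g +ᵥ x) '' K) :
    ((⋃ h : Fin d → ℤ, (fun x => ((s : ℤ) • h) +ᵥ x) '' Ktilde) = Set.univ) ∧
    (∀ h : Fin d → ℤ,
      ((fun x => ((s : ℤ) • h) +ᵥ x) '' Ktilde ∩ Ktilde).Nonempty →
      ∀ i, |h i| ≤ 1) := by
  have hspos : (0 : ℤ) < s := by exact_mod_cast hs
  subst hKtilde
  constructor
  · refine Set.eq_univ_of_forall fun x => ?_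
    have hx : x ∈ ⋃ g : Fin d → ℤ, (fun x => g +ᵥ x) '' K := hcover ▸ Set.mem_univ x
    obtain ⟨g, y, hy, rfl⟩ := Set.mem_iUnion.1 hx
    refine Set.mem_iUnion.2 ⟨fun i => g i / s, (fun i => g i % s) +ᵥ y, ?_, ?_⟩
    · refine Set.mem_biUnion (fun i => ?_) ⟨y, hy, rfl⟩
      exact ⟨Int.emod_nonneg _ hspos.ne', Int.le_sub_one_of_lt (Int.emod_lt_of_pos _ hspos)⟩
    · simp only [vadd_vadd]
      congr 1
      ext i
      simpa using Int.mul_ediv_add_emod (g i) s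
  · rintro h ⟨_, ⟨z, hz, rfl⟩, hz'⟩ i
    obtain ⟨g, hg, x, hx, rfl⟩ := Set.mem_iUnion₂.1 hz
    obtain ⟨g', hg', y, hy, hxy⟩ := Set.mem_iUnion₂.1 hz'
    have hmove : (-g' + ((s : ℤ) • h + g)) +ᵥ x = y := by
      simp only at hxy
      rw [add_vadd, add_vadd, ← hxy, neg_vadd_vadd]
    have hlt : |-g' i + (s * h i + g i)| < s := by
      by_contra! hle
      have hempty := hsep (-g' + ((s : ℤ) • h + g)) ⟨i, by simpa using hle⟩
      exact Set.notMem_empty y (hempty ▸ ⟨⟨x, hx, hmove⟩, hy⟩)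
    have hgi := hg i
    have hgi' := hg' i
    rw [abs_lt] at hlt
    rw [abs_le]
    constructor <;> by_contra! hlarge <;> nlinarith
end

section
/- For every differentiable u : ℝ → ℝ with u and its derivative u′ square-integrable on ℝ, one has ∫_ℝ u(x)⁶ dx ≤ (4/π²) (∫_ℝ u(x)² dx)² (∫_ℝ |u′(x)|² dx). Moreover, 4/π² is the smallest constant for which this inequality holds for all such u. -/
open MeasureTheory

open Set Filter Topology

/-- A function in `L²` with derivative in `L²` is bounded. -/
theorem exists_sq_le_of_integrable_sq_deriv {u u' : ℝ → ℝ}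
    (hu : ∀ x, HasDerivAt u (u' x) x) (h2 : Integrable fun x => u x ^ 2)
    (huu' : Integrable fun x => u x * u' x) : ∃ B, ∀ x, u x ^ 2 ≤ B := by
  have hd (x : ℝ) : HasDerivAt (fun x => u x ^ 2) (2 * (u x * u' x)) x :=
    ((hu x).pow 2).congr_deriv (by simp; ring)
  have hint : Integrable fun x => 2 * (u x * u' x) := huu'.const_mul 2
  refine ⟨∫ x, ‖2 * (u x * u' x)‖, fun x => ?_⟩
  have hbot := tendsto_zero_of_hasDerivAt_of_integrableOn_Iic (a := 0) (fun x _ => hd x)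
    hint.integrableOn h2.integrableOn
  have key := integral_Iic_of_hasDerivAt_of_tendsto' (a := x) (fun x _ => hd x)
    hint.integrableOn hbot
  calc u x ^ 2 = ∫ y in Iic x, 2 * (u y * u' y) := by rw [key, sub_zero]
    _ ≤ ‖∫ y in Iic x, 2 * (u y * u' y)‖ := le_abs_self _
    _ ≤ ∫ y in Iic x, ‖2 * (u y * u' y)‖ := norm_integral_le_integral_norm _
    _ ≤ ∫ y, ‖2 * (u y * u' y)‖ :=
      setIntegral_le_integral hint.norm (ae_of_all _ fun _ => norm_nonneg _)

/-- The sextic inequality with a subcritical parameter `a`, obtained by completing a square with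
the tangent of the rescaled cumulative mass `a * (∫ y in Iic x, u y ^ 2 - M / 2)`. -/
theorem mul_integral_pow_six_le_integral_deriv_sq {u u' : ℝ → ℝ} {a : ℝ}
    (hu : ∀ x, HasDerivAt u (u' x) x) (h2 : Integrable fun x => u x ^ 2)
    (h2' : Integrable fun x => u' x ^ 2) (ha : 0 ≤ a) (haM : a * ∫ x, u x ^ 2 < Real.pi) :
    a ^ 2 / 4 * ∫ x, u x ^ 6 ≤ ∫ x, u' x ^ 2 := by
  have hcont : Continuous u := continuous_iff_continuousAt.2 fun x => (hu x).continuousAt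
  have hmeas : Measurable u' := by
    have : u' = deriv u := funext fun x => (hu x).deriv.symm
    exact this ▸ measurable_deriv u
  have huu' : Integrable fun x => u x * u' x := by
    refine (h2.add h2').mono' (hcont.measurable.mul hmeas).aestronglyMeasurable
      (ae_of_all _ fun x => ?_)
    simp only [Real.norm_eq_abs, Pi.add_apply]
    rw [abs_le]
    constructor <;> nlinarith [sq_nonneg (u x + u' x), sq_nonneg (u x - u' x)]
  obtain ⟨B, hB⟩ := exists_sq_le_of_integrable_sq_deriv hu h2 huu'
  have h4 : Integrable fun x => u x ^ 4 := by
    refine (h2.const_mul B).mono' (hcont.pow 4).aestronglyMeasurable (ae_of_all _ fun x => ?_)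
    rw [Real.norm_of_nonneg (by positivity)]
    nlinarith [hB x, sq_nonneg (u x)]
  have h6 : Integrable fun x => u x ^ 6 := by
    refine (h4.const_mul B).mono' (hcont.pow 6).aestronglyMeasurable (ae_of_all _ fun x => ?_)
    rw [Real.norm_of_nonneg (by positivity)]
    have : 0 ≤ u x ^ 4 := by positivity
    nlinarith [hB x]
  have h31 : Integrable fun x => u x ^ 3 * u' x := by
    refine (huu'.norm.const_mul B).mono' ((hcont.measurable.pow_const 3).mul
      hmeas).aestronglyMeasurable (ae_of_all _ fun x => ?_)
    calc ‖u x ^ 3 * u' x‖ = u x ^ 2 * ‖u x * u' x‖ := by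
          rw [show u x ^ 3 * u' x = u x ^ 2 * (u x * u' x) by ring, norm_mul,
            Real.norm_of_nonneg (sq_nonneg (u x))]
      _ ≤ B * ‖u x * u' x‖ := by gcongr; exact hB x
  set M := ∫ x, u x ^ 2 with hM
  let F : ℝ → ℝ := fun x => ∫ y in Iic x, u y ^ 2
  have hF0 (x : ℝ) : 0 ≤ F x := integral_nonneg fun _ => sq_nonneg _
  have hFM (x : ℝ) : F x ≤ M := setIntegral_le_integral h2 (ae_of_all _ fun _ => sq_nonneg _)
  have hF (x : ℝ) : HasDerivAt F (u x ^ 2) x := by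
    have h := (intervalIntegral.integral_hasDerivAt_right (h2.intervalIntegrable (a := 0) (b := x))
      (hcont.pow 2).stronglyMeasurable.stronglyMeasurableAtFilter
      (hcont.pow 2).continuousAt).const_add (F 0)
    refine h.congr_of_eventuallyEq (Eventually.of_forall fun y => ?_)
    have := intervalIntegral.integral_Iic_sub_Iic (h2.integrableOn (s := Iic 0))
      (h2.integrableOn (s := Iic y))
    simp only [F, ← this]
    ring
  let T : ℝ → ℝ := fun x => Real.tan (a * (F x - M / 2))
  have hM0 : 0 ≤ a * M := mul_nonneg ha (integral_nonneg fun _ => sq_nonneg _)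
  have hlo (x : ℝ) : -(a * M / 2) ≤ a * (F x - M / 2) := by nlinarith [hF0 x]
  have hhi (x : ℝ) : a * (F x - M / 2) ≤ a * M / 2 := by nlinarith [hFM x]
  have hcos (x : ℝ) : Real.cos (a * (F x - M / 2)) ≠ 0 :=
    (Real.cos_pos_of_mem_Ioo ⟨by linarith [hlo x], by linarith [hhi x]⟩).ne'
  have hT (x : ℝ) : HasDerivAt T ((1 + T x ^ 2) * (a * u x ^ 2)) x := by
    have h := (Real.hasDerivAt_tan (hcos x)).comp x (((hF x).sub_const (M / 2)).const_mul a)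
    refine h.congr_deriv ?_
    rw [one_div, ← Real.inv_one_add_tan_sq (hcos x), inv_inv]
  have hTB (x : ℝ) : |T x| ≤ Real.tan (a * M / 2) := by
    have hmono := Real.strictMonoOn_tan.monotoneOn
    have m1 : a * M / 2 ∈ Ioo (-(Real.pi / 2)) (Real.pi / 2) :=
      ⟨by linarith [Real.pi_pos], by linarith⟩
    have m2 : -(a * M / 2) ∈ Ioo (-(Real.pi / 2)) (Real.pi / 2) :=
      ⟨by linarith, by linarith [Real.pi_pos]⟩
    have m3 : a * (F x - M / 2) ∈ Ioo (-(Real.pi / 2)) (Real.pi / 2) :=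
      ⟨by linarith [hlo x], by linarith [hhi x]⟩
    rw [abs_le, ← Real.tan_neg]
    exact ⟨hmono m2 m3 (hlo x), hmono m3 m1 (hhi x)⟩
  have hTcont : Continuous T := continuous_iff_continuousAt.2 fun x => (hT x).continuousAt
  have hTmul {f : ℝ → ℝ} (hf : Integrable f) : Integrable fun x => T x * f x :=
    hf.bdd_mul hTcont.aestronglyMeasurable (ae_of_all _ hTB)
  have hG (x : ℝ) : HasDerivAt (fun x => -(a / 4) * (T x * u x ^ 4))
      (-(a ^ 2 / 4) * (u x ^ 6 + T x * (T x * u x ^ 6)) - a * (T x * (u x ^ 3 * u' x))) x := by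
    have h := ((hT x).mul ((hu x).pow 4)).const_mul (-(a / 4))
    refine h.congr_deriv ?_
    simp
    ring
  have hI1 : Integrable fun x =>
      -(a ^ 2 / 4) * (u x ^ 6 + T x * (T x * u x ^ 6)) - a * (T x * (u x ^ 3 * u' x)) := ((h6.add (hTmul (hTmul h6))).const_mul (-(a ^ 2 / 4))).sub
    ((hTmul h31).const_mul a)
  have hzero := integral_eq_zero_of_hasDerivAt_of_integrable hG hI1
    ((hTmul h4).const_mul (-(a / 4)))
  have hle : ∫ x, (a ^ 2 / 4 * u x ^ 6 + (-(a ^ 2 / 4) * (u x ^ 6 + T x * (T x * u x ^ 6)) -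
      a * (T x * (u x ^ 3 * u' x)))) ≤ ∫ x, u' x ^ 2 := by
    refine integral_mono ((h6.const_mul _).add hI1) h2' fun x => ?_
    simp only
    nlinarith [sq_nonneg (u' x + a / 2 * T x * u x ^ 3)]
  rw [integral_add (h6.const_mul _) hI1, hzero, integral_const_mul, add_zero] at hle
  exact hle

theorem pi_sq_div_four_mul_integral_pow_six_le {u u' : ℝ → ℝ}
    (hu : ∀ x, HasDerivAt u (u' x) x) (h2 : Integrable fun x => u x ^ 2)
    (h2' : Integrable fun x => u' x ^ 2) :
    ∫ x, u x ^ 6 ≤ 4 / Real.pi ^ 2 * (∫ x, u x ^ 2) ^ 2 * ∫ x, u' x ^ 2 := by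
  have hpi := Real.pi_pos
  rcases (integral_nonneg fun x => sq_nonneg (u x) : 0 ≤ ∫ x, u x ^ 2).eq_or_lt with hM | hM
  · have h0 : (fun x => u x ^ 2) =ᵐ[volume] 0 :=
      (integral_eq_zero_iff_of_nonneg (fun x => sq_nonneg (u x)) h2).1 hM.symm
    have h6 : (fun x => u x ^ 6) =ᵐ[volume] 0 := by
      filter_upwards [h0] with x hx
      simpa using hx
    simp [integral_congr_ae h6, ← hM]
  · set M := ∫ x, u x ^ 2
    have hlim : Tendsto (fun a : ℝ => a ^ 2 / 4 * ∫ x, u x ^ 6) (𝓝[<] (Real.pi / M))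
        (𝓝 ((Real.pi / M) ^ 2 / 4 * ∫ x, u x ^ 6)) :=
      (Continuous.tendsto (by fun_prop) _).mono_left nhdsWithin_le_nhds
    have hle : (Real.pi / M) ^ 2 / 4 * ∫ x, u x ^ 6 ≤ ∫ x, u' x ^ 2 := by
      refine le_of_tendsto hlim ?_
      filter_upwards [Ioo_mem_nhdsLT (show (0 : ℝ) < Real.pi / M by positivity)] with a ha
      exact mul_integral_pow_six_le_integral_deriv_sq hu h2 h2' ha.1.le ((lt_div_iff₀ hM).1 ha.2)
    calc ∫ x, u x ^ 6
        = 4 / Real.pi ^ 2 * M ^ 2 * ((Real.pi / M) ^ 2 / 4 * ∫ x, u x ^ 6) := by field_simp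
      _ ≤ _ := by gcongr

theorem Real.half_one_add_sq_le_cosh (x : ℝ) : (1 + x ^ 2) / 2 ≤ Real.cosh x := by
  have h1 : Real.cosh x = 1 + 2 * Real.sinh (x / 2) ^ 2 := by
    have h := Real.cosh_two_mul (x / 2)
    rw [mul_div_cancel₀ x two_ne_zero, Real.cosh_sq] at h
    linarith
  have h2 : (x / 2) ^ 2 ≤ Real.sinh (x / 2) ^ 2 := by
    rcases le_total 0 (x / 2) with h | h
    · exact pow_le_pow_left₀ h (Real.self_le_sinh_iff.2 h) 2
    · nlinarith [Real.sinh_le_self_iff.2 h]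
  nlinarith

theorem integrable_inv_cosh : Integrable fun x : ℝ => (Real.cosh x)⁻¹ := by
  refine (integrable_inv_one_add_sq.const_mul 2).mono'
    (Real.continuous_cosh.inv₀ fun x => (Real.cosh_pos x).ne').aestronglyMeasurable
    (ae_of_all _ fun x => ?_)
  rw [Real.norm_of_nonneg (inv_nonneg.2 (Real.cosh_pos x).le)]
  calc (Real.cosh x)⁻¹ ≤ ((1 + x ^ 2) / 2)⁻¹ :=
        inv_anti₀ (by positivity) (Real.half_one_add_sq_le_cosh x)
    _ = 2 * (1 + x ^ 2)⁻¹ := by field_simp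

theorem integral_inv_cosh : ∫ x : ℝ, (Real.cosh x)⁻¹ = Real.pi := by
  have hd (x : ℝ) : HasDerivAt (fun x => Real.arctan (Real.sinh x)) (Real.cosh x)⁻¹ x := by
    have h := (Real.hasDerivAt_sinh x).arctan
    refine h.congr_deriv ?_
    have := (Real.cosh_pos x).ne'
    rw [add_comm, ← Real.cosh_sq]
    field_simp
  rw [integral_of_hasDerivAt_of_tendsto hd integrable_inv_cosh
    ((Real.tendsto_arctan_atBot.mono_right nhdsWithin_le_nhds).comp
      Real.sinhOrderIso.tendsto_atBot)
    ((Real.tendsto_arctan_atTop.mono_right nhdsWithin_le_nhds).comp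
      Real.sinhOrderIso.tendsto_atTop)]
  ring

theorem integrable_inv_cosh_pow_three : Integrable fun x : ℝ => (Real.cosh x)⁻¹ ^ 3 := by
  refine integrable_inv_cosh.mono' ((Real.continuous_cosh.inv₀
    fun x => (Real.cosh_pos x).ne').pow 3).aestronglyMeasurable (ae_of_all _ fun x => ?_)
  have h0 := inv_nonneg.2 (Real.cosh_pos x).le
  rw [Real.norm_of_nonneg (pow_nonneg h0 3)]
  exact pow_le_of_le_one h0 (inv_le_one_of_one_le₀ (Real.one_le_cosh x)) three_ne_zero

theorem integral_inv_cosh_pow_three : ∫ x : ℝ, (Real.cosh x)⁻¹ ^ 3 = Real.pi / 2 := by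
  have hd (x : ℝ) : HasDerivAt (fun x => Real.sinh x / Real.cosh x ^ 2)
      (2 * (Real.cosh x)⁻¹ ^ 3 - (Real.cosh x)⁻¹) x := by
    have hc := (Real.cosh_pos x).ne'
    have h := (Real.hasDerivAt_sinh x).div ((Real.hasDerivAt_cosh x).pow 2) (pow_ne_zero 2 hc)
    refine h.congr_deriv ?_
    simp
    field_simp
    rw [Real.sinh_sq]
    ring
  have hint : Integrable fun x => Real.sinh x / Real.cosh x ^ 2 := by
    refine integrable_inv_cosh.mono' (Real.continuous_sinh.div (Real.continuous_cosh.pow 2)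
      fun x => pow_ne_zero 2 (Real.cosh_pos x).ne').aestronglyMeasurable (ae_of_all _ fun x => ?_)
    have hc := Real.cosh_pos x
    have hs : |Real.sinh x| ≤ Real.cosh x :=
      abs_le_of_sq_le_sq (by linarith [Real.cosh_sq x]) hc.le
    rw [norm_div, Real.norm_of_nonneg (pow_nonneg hc.le 2), Real.norm_eq_abs,
      div_le_iff₀ (by positivity)]
    calc |Real.sinh x| ≤ Real.cosh x := hs
      _ = (Real.cosh x)⁻¹ * Real.cosh x ^ 2 := by field_simp
  have h := integral_eq_zero_of_hasDerivAt_of_integrable hd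
    ((integrable_inv_cosh_pow_three.const_mul 2).sub integrable_inv_cosh) hint
  rw [integral_sub (integrable_inv_cosh_pow_three.const_mul 2) integrable_inv_cosh,
    integral_const_mul, integral_inv_cosh] at h
  linarith

theorem hasDerivAt_inv_sqrt_cosh (x : ℝ) :
    HasDerivAt (fun x => (√(Real.cosh x))⁻¹)
      (-(Real.sinh x / (2 * √(Real.cosh x))) / √(Real.cosh x) ^ 2) x :=
  ((Real.hasDerivAt_cosh x).sqrt (Real.cosh_pos x).ne').inv
    (Real.sqrt_pos.2 (Real.cosh_pos x)).ne'

/-- sharp sextic Gagliardo–Nirenberg inequality on ℝ, with optimal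
constant 4/π². -/
theorem sharp_sextic_GN_on_R :
    (∀ u : ℝ → ℝ, Differentiable ℝ u →
      (Integrable fun x => (u x) ^ 2) →
      (Integrable fun x => (deriv u x) ^ 2) →
      (∫ x : ℝ, (u x) ^ 6) ≤
        4 / Real.pi ^ 2 * (∫ x : ℝ, (u x) ^ 2) ^ 2 * ∫ x : ℝ, (deriv u x) ^ 2) ∧
    ∀ C : ℝ,
      (∀ u : ℝ → ℝ, Differentiable ℝ u →
        (Integrable fun x => (u x) ^ 2) →
        (Integrable fun x => (deriv u x) ^ 2) →
        (∫ x : ℝ, (u x) ^ 6) ≤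
          C * (∫ x : ℝ, (u x) ^ 2) ^ 2 * ∫ x : ℝ, (deriv u x) ^ 2) →
      4 / Real.pi ^ 2 ≤ C := by
  refine ⟨fun u hu h2 h2' =>
    pi_sq_div_four_mul_integral_pow_six_le (fun x => (hu x).hasDerivAt) h2 h2', fun C hC => ?_⟩
  have hpi := Real.pi_pos
  have e2 (x : ℝ) : (√(Real.cosh x))⁻¹ ^ 2 = (Real.cosh x)⁻¹ := by
    rw [inv_pow, Real.sq_sqrt (Real.cosh_pos x).le]
  have e6 (x : ℝ) : (√(Real.cosh x))⁻¹ ^ 6 = (Real.cosh x)⁻¹ ^ 3 := by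
    rw [← e2, ← pow_mul]
  have ed (x : ℝ) : deriv (fun x => (√(Real.cosh x))⁻¹) x ^ 2 =
      1 / 4 * ((Real.cosh x)⁻¹ - (Real.cosh x)⁻¹ ^ 3) := by
    have hc := Real.cosh_pos x
    rw [(hasDerivAt_inv_sqrt_cosh x).deriv, Real.sq_sqrt hc.le, div_pow, neg_sq, div_pow, mul_pow,
      Real.sq_sqrt hc.le, Real.sinh_sq]
    field_simp
    norm_num
  have h := hC (fun x => (√(Real.cosh x))⁻¹)
    (fun x => (hasDerivAt_inv_sqrt_cosh x).differentiableAt)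
    (by simpa only [e2] using integrable_inv_cosh)
    (by simp only [ed]; exact (integrable_inv_cosh.sub integrable_inv_cosh_pow_three).const_mul _)
  simp only [e2, e6, ed] at h
  rw [integral_const_mul, integral_sub integrable_inv_cosh integrable_inv_cosh_pow_three,
    integral_inv_cosh, integral_inv_cosh_pow_three] at h
  rw [div_le_iff₀ (by positivity)]
  nlinarith
end

section
/- For every continuous u : [0, ∞) → ℝ that is differentiable on (0, ∞) with u and its derivative u′ square-integrable on (0, ∞), one has ∫_0^∞ u(x)⁶ dx ≤ (16/π²) (∫_0^∞ u(x)² dx)² (∫_0^∞ |u′(x)|² dx). Moreover, 16/π² is the smallest constant for which this inequality holds for all such u. -/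
open MeasureTheory

open Set Filter Topology

section UpperBound

variable {u : ℝ → ℝ}

/-- A calibration estimate: completing the square in `u' + (k / 2) cot θ u ^ 3`, where
`θ x = k (M - ∫₀ˣ u ^ 2)`, bounds `∫ u ^ 6` by `∫ u' ^ 2` and a boundary term. -/
lemma sq_mul_integral_pow_six_le {k M R : ℝ} (hu : Continuous u)
    (hdiff : ∀ x ∈ Ioi (0 : ℝ), DifferentiableAt ℝ u x)
    (hderiv : IntegrableOn (fun x => (deriv u x) ^ 2) (Ioi 0))
    (hk : 0 < k) (hkM : k * M = Real.pi / 2) (hR : 0 ≤ R)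
    (hM : ∫ x in (0 : ℝ)..R, (u x) ^ 2 < M) :
    k ^ 2 * ∫ x in (0 : ℝ)..R, (u x) ^ 6 ≤
      4 * (∫ x in (0 : ℝ)..R, (deriv u x) ^ 2) +
        k * (Real.cot (k * (M - ∫ x in (0 : ℝ)..R, (u x) ^ 2)) * (u R) ^ 4) := by
  set θ : ℝ → ℝ := fun y => k * (M - ∫ x in (0 : ℝ)..y, (u x) ^ 2) with hθ
  have hu2 : Continuous fun x => (u x) ^ 2 := hu.pow 2
  have hθ' (y : ℝ) : HasDerivAt θ (k * (-(u y) ^ 2)) y := by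
    have := (intervalIntegral.integral_hasDerivAt_right (hu2.intervalIntegrable 0 y)
      (hu2.stronglyMeasurableAtFilter _ _) hu2.continuousAt)
    exact (this.const_sub M).const_mul k
  have hθsin {y : ℝ} (hy : y ∈ Icc 0 R) : 0 < Real.sin (θ y) := by
    have h0 : 0 ≤ ∫ x in (0 : ℝ)..y, (u x) ^ 2 :=
      intervalIntegral.integral_nonneg hy.1 fun x _ => sq_nonneg _
    have h1 : 0 ≤ ∫ x in y..R, (u x) ^ 2 :=
      intervalIntegral.integral_nonneg hy.2 fun x _ => sq_nonneg _
    have h2 := intervalIntegral.integral_add_adjacent_intervals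
      (hu2.intervalIntegrable (μ := volume) 0 y) (hu2.intervalIntegrable (μ := volume) y R)
    apply Real.sin_pos_of_pos_of_lt_pi
    · exact mul_pos hk (by linarith)
    · have : θ y ≤ k * M := mul_le_mul_of_nonneg_left (by linarith) hk.le
      linarith [Real.pi_pos]
  have hθcont : Continuous θ := continuous_iff_continuousAt.2 fun y => (hθ' y).continuousAt
  have hint4 : IntegrableOn (fun x => (deriv u x) ^ 2) (Icc 0 R) :=
    integrableOn_Icc_iff_integrableOn_Ioc (by simp) |>.2 (hderiv.mono_set Ioc_subset_Ioi_self)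
  have hint6 : IntegrableOn (fun x => (u x) ^ 6) (Icc 0 R) :=
    (hu.pow 6).continuousOn.integrableOn_Icc
  have key := intervalIntegral.sub_le_integral_of_hasDeriv_right_of_le hR
    (g := fun y => -(k * (Real.cos (θ y) / Real.sin (θ y) * (u y) ^ 4)))
    (g' := fun y => -(k * (k * (u y) ^ 2 / Real.sin (θ y) ^ 2 * (u y) ^ 4 +
      Real.cos (θ y) / Real.sin (θ y) * (4 * (u y) ^ 3 * deriv u y))))
    (φ := fun y => 4 * (deriv u y) ^ 2 - k ^ 2 * (u y) ^ 6) ?_ ?_ ?_ ?_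
  · rw [intervalIntegral.integral_sub, intervalIntegral.integral_const_mul,
      intervalIntegral.integral_const_mul] at key
    · have h0 : Real.cos (θ 0) = 0 := by simp [hθ, hkM]
      rw [h0] at key
      rw [Real.cot_eq_cos_div_sin]
      simp only [hθ, zero_div, zero_mul, mul_zero, neg_zero, sub_zero] at key ⊢
      linarith
    · exact ((intervalIntegrable_iff_integrableOn_Icc_of_le hR).2 hint4).const_mul 4
    · exact ((hu.pow 6).intervalIntegrable 0 R).const_mul _
  · exact ((continuousOn_const.mul (((Real.continuous_cos.comp hθcont).continuousOn.div
      (Real.continuous_sin.comp hθcont).continuousOn fun y hy => (hθsin hy).ne').mul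
      (hu.pow 4).continuousOn))).neg
  · intro y hy
    have hs := (hθsin (Ioo_subset_Icc_self hy)).ne'
    have h1 := ((hθ' y).cos.div (hθ' y).sin hs).mul ((hdiff y hy.1).hasDerivAt.pow 4)
    refine HasDerivAt.hasDerivWithinAt (HasDerivAt.congr_deriv (h1.const_mul k).neg ?_)
    have := Real.sin_sq_add_cos_sq (θ y)
    have h3 : k * (u y) ^ 2 / Real.sin (θ y) ^ 2 =
      (-Real.sin (θ y) * (k * -u y ^ 2) * Real.sin (θ y) -
        Real.cos (θ y) * (Real.cos (θ y) * (k * -u y ^ 2))) / Real.sin (θ y) ^ 2 := by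
      congr 1
      linear_combination (-(k * u y ^ 2)) * this
    rw [h3]
    simp
  · exact (hint4.const_mul 4).sub (hint6.const_mul _)
  · intro y hy
    have hs := (hθsin (Ioo_subset_Icc_self hy)).ne'
    have h1 : k * (u y) ^ 2 / Real.sin (θ y) ^ 2 =
        k * (u y) ^ 2 * (1 + (Real.cos (θ y) / Real.sin (θ y)) ^ 2) := by
      field_simp
      linear_combination -(u y ^ 2) * Real.sin_sq_add_cos_sq (θ y)
    rw [h1]
    nlinarith [sq_nonneg (2 * deriv u y + k * (Real.cos (θ y) / Real.sin (θ y)) * (u y) ^ 3)]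

lemma tendsto_sq_atTop_zero (hu : Continuous u)
    (hdiff : ∀ x ∈ Ioi (0 : ℝ), DifferentiableAt ℝ u x)
    (hsq : IntegrableOn (fun x => (u x) ^ 2) (Ioi 0))
    (hderiv : IntegrableOn (fun x => (deriv u x) ^ 2) (Ioi 0)) :
    Tendsto (fun x => (u x) ^ 2) atTop (𝓝 0) := by
  refine tendsto_zero_of_hasDerivAt_of_integrableOn_Ioi (a := 0)
    (f' := fun x => 2 * u x * deriv u x) (fun x hx => ?_) ?_ hsq
  · exact ((hdiff x hx).hasDerivAt.pow 2).congr_deriv (by simp)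
  · refine (hsq.add hderiv).mono'
      ((hu.measurable.const_mul 2).mul (measurable_deriv u)).aestronglyMeasurable ?_
    refine Eventually.of_forall fun x => ?_
    simp only [Real.norm_eq_abs, Pi.add_apply]
    exact abs_le.2 ⟨by nlinarith [sq_nonneg (u x + deriv u x)],
      by nlinarith [sq_nonneg (u x - deriv u x)]⟩

lemma integral_pow_six_le_of_continuous (hu : Continuous u)
    (hdiff : ∀ x ∈ Ioi (0 : ℝ), DifferentiableAt ℝ u x)
    (hsq : IntegrableOn (fun x => (u x) ^ 2) (Ioi 0))
    (hderiv : IntegrableOn (fun x => (deriv u x) ^ 2) (Ioi 0)) :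
    (∫ x in Ioi (0 : ℝ), (u x) ^ 6) ≤
      16 / Real.pi ^ 2 * (∫ x in Ioi (0 : ℝ), (u x) ^ 2) ^ 2 *
        ∫ x in Ioi (0 : ℝ), (deriv u x) ^ 2 := by
  set A := ∫ x in Ioi (0 : ℝ), (u x) ^ 2 with hA
  set D := ∫ x in Ioi (0 : ℝ), (deriv u x) ^ 2 with hD
  have hA0 : 0 ≤ A := integral_nonneg fun x => sq_nonneg _
  have hD0 : 0 ≤ D := integral_nonneg fun x => sq_nonneg _
  by_cases h6 : IntegrableOn (fun x => (u x) ^ 6) (Ioi 0)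
  swap
  · rw [integral_undef h6]
    positivity
  have hpi := Real.pi_pos
  have main {M : ℝ} (hM : A < M) :
      (∫ x in Ioi (0 : ℝ), (u x) ^ 6) ≤ 16 / Real.pi ^ 2 * M ^ 2 * D := by
    have hM0 : 0 < M := hA0.trans_lt hM
    obtain ⟨k, hkdef⟩ : ∃ k, k = Real.pi / (2 * M) := ⟨_, rfl⟩
    have hk : 0 < k := by rw [hkdef]; positivity
    have hkM : k * M = Real.pi / 2 := by rw [hkdef]; field_simp
    have t2 := intervalIntegral_tendsto_integral_Ioi 0 hsq tendsto_id
    have t6 := intervalIntegral_tendsto_integral_Ioi 0 h6 tendsto_id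
    have td := intervalIntegral_tendsto_integral_Ioi 0 hderiv tendsto_id
    have t0 := tendsto_sq_atTop_zero hu hdiff hsq hderiv
    have hsin : Real.sin (k * (M - A)) ≠ 0 := by
      refine (Real.sin_pos_of_pos_of_lt_pi (mul_pos hk (sub_pos.2 hM)) ?_).ne'
      nlinarith
    have tcot : Tendsto (fun R => Real.cot (k * (M - ∫ x in (0 : ℝ)..id R, (u x) ^ 2))) atTop
        (𝓝 (Real.cot (k * (M - A)))) := by
      simp only [Real.cot_eq_cos_div_sin]
      have h := (t2.const_sub M).const_mul k
      exact ((Real.continuous_cos.tendsto _).comp h).div ((Real.continuous_sin.tendsto _).comp h)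
        hsin
    have hle : k ^ 2 * (∫ x in Ioi (0 : ℝ), (u x) ^ 6) ≤
        4 * D + k * (Real.cot (k * (M - A)) * 0 ^ 2) := by
      refine le_of_tendsto_of_tendsto (t6.const_mul _)
        ((td.const_mul 4).add ((tcot.mul (t0.pow 2)).const_mul k)) ?_
      filter_upwards [eventually_ge_atTop 0] with R hR
      have hlt : ∫ x in (0 : ℝ)..R, (u x) ^ 2 < M := by
        refine lt_of_le_of_lt ?_ hM
        rw [intervalIntegral.integral_of_le hR]
        exact setIntegral_mono_set hsq (Eventually.of_forall fun x => sq_nonneg _)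
          Ioc_subset_Ioi_self.eventuallyLE
      have := sq_mul_integral_pow_six_le hu hdiff hderiv hk hkM hR hlt
      rw [← pow_mul]
      exact this
    have hk2 : 16 / Real.pi ^ 2 * M ^ 2 * D = 4 * D / k ^ 2 := by
      rw [hkdef]
      field_simp
      ring
    rw [hk2, le_div_iff₀ (by positivity)]
    linarith
  refine ge_of_tendsto (x := 𝓝[>] A) (f := fun M => 16 / Real.pi ^ 2 * M ^ 2 * D) ?_ ?_
  · have : Continuous fun M : ℝ => 16 / Real.pi ^ 2 * M ^ 2 * D := by fun_prop
    exact (this.tendsto A).mono_left nhdsWithin_le_nhds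
  · filter_upwards [self_mem_nhdsWithin] with M hM using main hM

lemma integral_pow_six_le (hu : ContinuousOn u (Ici 0))
    (hdiff : ∀ x ∈ Ioi (0 : ℝ), DifferentiableAt ℝ u x)
    (hsq : IntegrableOn (fun x => (u x) ^ 2) (Ioi 0))
    (hderiv : IntegrableOn (fun x => (deriv u x) ^ 2) (Ioi 0)) :
    (∫ x in Ioi (0 : ℝ), (u x) ^ 6) ≤
      16 / Real.pi ^ 2 * (∫ x in Ioi (0 : ℝ), (u x) ^ 2) ^ 2 *
        ∫ x in Ioi (0 : ℝ), (deriv u x) ^ 2 := by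
  set v : ℝ → ℝ := fun x => u (max x 0) with hv
  have hvc : Continuous v :=
    hu.comp_continuous (continuous_id.max continuous_const) fun x => mem_Ici.2 (le_max_right _ _)
  have hvu : EqOn v u (Ioi 0) := fun x hx => by simp [hv, max_eq_left (mem_Ioi.1 hx).le]
  have hnhds {x : ℝ} (hx : x ∈ Ioi (0 : ℝ)) : v =ᶠ[𝓝 x] u :=
    hvu.eventuallyEq_of_mem (Ioi_mem_nhds hx)
  have hdv : EqOn (fun x => (deriv v x) ^ 2) (fun x => (deriv u x) ^ 2) (Ioi 0) :=
    fun x hx => by simp only [(hnhds hx).deriv_eq]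
  have hpow (n : ℕ) : EqOn (fun x => (v x) ^ n) (fun x => (u x) ^ n) (Ioi 0) :=
    fun x hx => by simp only [hvu hx]
  have := integral_pow_six_le_of_continuous hvc
    (fun x hx => (hnhds hx).differentiableAt_iff.2 (hdiff x hx))
    (hsq.congr_fun (hpow 2).symm measurableSet_Ioi) (hderiv.congr_fun hdv.symm measurableSet_Ioi)
  rwa [setIntegral_congr_fun measurableSet_Ioi (hpow 6),
    setIntegral_congr_fun measurableSet_Ioi (hpow 2),
    setIntegral_congr_fun measurableSet_Ioi hdv] at this

end UpperBound

section Extremal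

lemma tendsto_sinh_atTop : Tendsto Real.sinh atTop atTop :=
  tendsto_atTop_mono' _ ((eventually_ge_atTop 0).mono fun _ hx => Real.self_le_sinh_iff.2 hx)
    tendsto_id

lemma tendsto_cosh_atTop : Tendsto Real.cosh atTop atTop :=
  tendsto_atTop_mono (fun x => (Real.sinh_lt_cosh x).le) tendsto_sinh_atTop

lemma tendsto_arctan_sinh_atTop :
    Tendsto (fun x => Real.arctan (Real.sinh x)) atTop (𝓝 (Real.pi / 2)) :=
  (tendsto_nhds_of_tendsto_nhdsWithin Real.tendsto_arctan_atTop).comp tendsto_sinh_atTop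

lemma hasDerivAt_arctan_sinh (x : ℝ) :
    HasDerivAt (fun x => Real.arctan (Real.sinh x)) (1 / Real.cosh x) x := by
  have hc := (Real.cosh_pos x).ne'
  refine (Real.hasDerivAt_sinh x).arctan.congr_deriv ?_
  rw [add_comm, ← Real.cosh_sq]
  field_simp

lemma hasDerivAt_sech_pow_three_primitive (x : ℝ) :
    HasDerivAt (fun x => (Real.sinh x / Real.cosh x ^ 2 + Real.arctan (Real.sinh x)) / 2)
      (1 / Real.cosh x ^ 3) x := by
  have hc := (Real.cosh_pos x).ne'
  refine ((((Real.hasDerivAt_sinh x).div ((Real.hasDerivAt_cosh x).pow 2)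
    (pow_ne_zero 2 hc)).add (hasDerivAt_arctan_sinh x)).div_const 2).congr_deriv ?_
  simp only [Pi.pow_apply]
  have := Real.cosh_sq x
  field_simp
  push_cast
  linear_combination 2 * Real.cosh x * this

lemma tendsto_sech_pow_three_primitive :
    Tendsto (fun x => (Real.sinh x / Real.cosh x ^ 2 + Real.arctan (Real.sinh x)) / 2) atTop
      (𝓝 (Real.pi / 4)) := by
  have h : Tendsto (fun x => Real.sinh x / Real.cosh x ^ 2) atTop (𝓝 0) := by
    refine squeeze_zero' ?_ ?_ (tendsto_inv_atTop_zero.comp tendsto_cosh_atTop)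
    · filter_upwards [eventually_ge_atTop 0] with x hx
      exact div_nonneg (Real.sinh_nonneg_iff.2 hx) (sq_nonneg _)
    · refine Eventually.of_forall fun x => ?_
      have hc := Real.cosh_pos x
      rw [Function.comp_apply, div_le_iff₀ (by positivity), sq, inv_mul_cancel_left₀ hc.ne']
      exact (Real.sinh_lt_cosh x).le
  convert (h.add tendsto_arctan_sinh_atTop).div_const 2 using 2
  ring

lemma integrableOn_sech : IntegrableOn (fun x => 1 / Real.cosh x) (Ioi 0) :=
  integrableOn_Ioi_deriv_of_nonneg' (fun x _ => hasDerivAt_arctan_sinh x)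
    (fun x _ => (div_pos one_pos (Real.cosh_pos x)).le) tendsto_arctan_sinh_atTop

lemma integral_sech : ∫ x in Ioi (0 : ℝ), 1 / Real.cosh x = Real.pi / 2 := by
  rw [integral_Ioi_of_hasDerivAt_of_nonneg' (fun x _ => hasDerivAt_arctan_sinh x)
    (fun x _ => (div_pos one_pos (Real.cosh_pos x)).le) tendsto_arctan_sinh_atTop]
  simp

lemma integrableOn_sech_pow_three : IntegrableOn (fun x => 1 / Real.cosh x ^ 3) (Ioi 0) :=
  integrableOn_Ioi_deriv_of_nonneg' (fun x _ => hasDerivAt_sech_pow_three_primitive x)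
    (fun x _ => (div_pos one_pos (pow_pos (Real.cosh_pos x) 3)).le)
    tendsto_sech_pow_three_primitive

lemma integral_sech_pow_three : ∫ x in Ioi (0 : ℝ), 1 / Real.cosh x ^ 3 = Real.pi / 4 := by
  rw [integral_Ioi_of_hasDerivAt_of_nonneg' (fun x _ => hasDerivAt_sech_pow_three_primitive x)
    (fun x _ => (div_pos one_pos (pow_pos (Real.cosh_pos x) 3)).le)
    tendsto_sech_pow_three_primitive]
  simp

/-- The extremal profile `sech ^ (1 / 2)`. -/
noncomputable def sqrtSech (x : ℝ) : ℝ := √(1 / Real.cosh x)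

lemma sqrtSech_sq (x : ℝ) : sqrtSech x ^ 2 = 1 / Real.cosh x :=
  Real.sq_sqrt (div_pos one_pos (Real.cosh_pos x)).le

lemma sqrtSech_pow_six (x : ℝ) : sqrtSech x ^ 6 = 1 / Real.cosh x ^ 3 := by
  rw [show sqrtSech x ^ 6 = (sqrtSech x ^ 2) ^ 3 by ring, sqrtSech_sq, div_pow, one_pow]

lemma hasDerivAt_sqrtSech (x : ℝ) :
    HasDerivAt sqrtSech (-(Real.sinh x / (2 * Real.cosh x)) * sqrtSech x) x := by
  have hc := Real.cosh_pos x
  have hpos : 0 < 1 / Real.cosh x := div_pos one_pos hc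
  have h := (((hasDerivAt_const x (1 : ℝ)).div (Real.hasDerivAt_cosh x) hc.ne').sqrt hpos.ne')
  have hs : 0 < sqrtSech x := Real.sqrt_pos.2 hpos
  have hsq := sqrtSech_sq x
  refine h.congr_deriv ?_
  change _ / (2 * sqrtSech x) = _
  symm
  rw [eq_div_iff (by positivity),
    show ∀ a b : ℝ, -a * b * (2 * b) = -2 * a * b ^ 2 by intros; ring, hsq]
  field_simp
  ring

lemma deriv_sqrtSech_sq (x : ℝ) :
    deriv sqrtSech x ^ 2 = (1 / Real.cosh x - 1 / Real.cosh x ^ 3) / 4 := by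
  have hc := (Real.cosh_pos x).ne'
  rw [(hasDerivAt_sqrtSech x).deriv, mul_pow, sqrtSech_sq]
  have := Real.cosh_sq x
  field_simp
  linear_combination -4 * this

end Extremal

/-- sharp sextic Gagliardo–Nirenberg inequality on the half-line
[0, ∞), with optimal constant 16/π². -/
theorem sharp_sextic_GN_on_halfline :
    (∀ u : ℝ → ℝ, ContinuousOn u (Set.Ici 0) →
      (∀ x ∈ Set.Ioi (0 : ℝ), DifferentiableAt ℝ u x) →
      IntegrableOn (fun x => (u x) ^ 2) (Set.Ioi 0) →
      IntegrableOn (fun x => (deriv u x) ^ 2) (Set.Ioi 0) →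
      (∫ x in Set.Ioi (0 : ℝ), (u x) ^ 6) ≤
        16 / Real.pi ^ 2 * (∫ x in Set.Ioi (0 : ℝ), (u x) ^ 2) ^ 2 *
          ∫ x in Set.Ioi (0 : ℝ), (deriv u x) ^ 2) ∧
    ∀ C : ℝ,
      (∀ u : ℝ → ℝ, ContinuousOn u (Set.Ici 0) →
        (∀ x ∈ Set.Ioi (0 : ℝ), DifferentiableAt ℝ u x) →
        IntegrableOn (fun x => (u x) ^ 2) (Set.Ioi 0) →
        IntegrableOn (fun x => (deriv u x) ^ 2) (Set.Ioi 0) →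
        (∫ x in Set.Ioi (0 : ℝ), (u x) ^ 6) ≤
          C * (∫ x in Set.Ioi (0 : ℝ), (u x) ^ 2) ^ 2 *
            ∫ x in Set.Ioi (0 : ℝ), (deriv u x) ^ 2) →
      16 / Real.pi ^ 2 ≤ C := by
  refine ⟨fun u hu hdiff hsq hderiv => integral_pow_six_le hu hdiff hsq hderiv, fun C hC => ?_⟩
  have h := hC sqrtSech
    (fun x _ => (hasDerivAt_sqrtSech x).continuousAt.continuousWithinAt)
    (fun x _ => (hasDerivAt_sqrtSech x).differentiableAt)
    (by simpa only [sqrtSech_sq] using integrableOn_sech)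
    (by
      simp only [deriv_sqrtSech_sq]
      exact Integrable.div_const (integrableOn_sech.sub integrableOn_sech_pow_three) (4 : ℝ))
  simp only [sqrtSech_sq, sqrtSech_pow_six, deriv_sqrtSech_sq] at h
  rw [integral_div, integral_sub integrableOn_sech integrableOn_sech_pow_three, integral_sech,
    integral_sech_pow_three] at h
  have hpi := Real.pi_pos
  rw [div_le_iff₀ (by positivity)]
  have h' : Real.pi * 16 ≤ Real.pi * (C * Real.pi ^ 2) := by linarith
  exact le_of_mul_le_mul_left h' hpi
end

section
/- Let 2 < q < p ≤ 6 and α > 0, and suppose either p < 6 and μ > 0, or p = 6 and 0 < μ < μ_ℝ. Then −∞ < 𝓔_{p,q,α}(μ) < 0 and there exists a ground state of mass μ, i.e. some u ∈ H¹_μ(ℝ) with E_{p,q,α}(u) = 𝓔_{p,q,α}(μ). -/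
open MeasureTheory

/-- The NLS energy with combined nonlinearities on the real line. -/
noncomputable def NLSenergy (p q α : ℝ) (u : ℝ → ℝ) : ℝ :=
  ∫ x : ℝ, ((1 / 2) * (deriv u x) ^ 2 - (1 / p) * |u x| ^ p - (α / q) * |u x| ^ q)

/-- Membership in H¹_μ(ℝ): differentiable, u and u′ square-integrable, mass μ. -/
def InH1mass (μ : ℝ) (u : ℝ → ℝ) : Prop :=
  Differentiable ℝ u ∧ (Integrable fun x => (u x) ^ 2) ∧
    (Integrable fun x => (deriv u x) ^ 2) ∧ (∫ x : ℝ, (u x) ^ 2) = μ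

/-- The ground-state energy level 𝓔_{p,q,α}(μ), as an extended real number. -/
noncomputable def groundLevel (p q α μ : ℝ) : EReal :=
  sInf ((fun u : ℝ → ℝ => ((NLSenergy p q α u : ℝ) :  EReal)) '' {u | InH1mass μ u})

/-- The critical mass of the real line: μ_ℝ = (√3/2)π. -/
noncomputable def muR : ℝ := Real.sqrt 3 / 2 * Real.pi

open Set Filter Topology

/-- The abbreviated action of the soliton of maximum `M` for the potential `V`. -/
noncomputable def solitonAction (V : ℝ → ℝ) (M : ℝ) : ℝ :=
  ∫ s in (0 : ℝ)..M, s * √(V M - V s)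

/-- The energy of a profile of mass `μ` and maximum `M` solving the first-order soliton
equation. -/
noncomputable def profileEnergy (V : ℝ → ℝ) (μ M : ℝ) : ℝ :=
  2 * solitonAction V M - V M * (μ / 2)

theorem InH1mass.integrable_mul_deriv {μ : ℝ} {u : ℝ → ℝ} (hu : InH1mass μ u) :
    Integrable fun x => u x * deriv u x := by
  obtain ⟨hd, h1, h2, -⟩ := hu
  refine (h1.add h2).mono' (hd.continuous.measurable.mul (measurable_deriv u)).aestronglyMeasurable
    (Eventually.of_forall fun x => ?_)
  simp only [Pi.add_apply, Real.norm_eq_abs, abs_le]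
  constructor <;> nlinarith [sq_nonneg (u x + deriv u x), sq_nonneg (u x - deriv u x),
    sq_nonneg (u x), sq_nonneg (deriv u x)]

theorem tendsto_zero_of_sq {l : Filter ℝ} {u : ℝ → ℝ} (h : Tendsto (fun x => u x ^ 2) l (𝓝 0)) :
    Tendsto u l (𝓝 0) := by
  have := (Real.continuous_sqrt.tendsto 0).comp h
  simp only [Real.sqrt_zero, Function.comp_def, Real.sqrt_sq_eq_abs] at this
  exact (tendsto_zero_iff_abs_tendsto_zero u).2 this

theorem InH1mass.tendsto_zero {μ : ℝ} {u : ℝ → ℝ} (hu : InH1mass μ u) :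
    Tendsto u atTop (𝓝 0) ∧ Tendsto u atBot (𝓝 0) := by
  have hd : ∀ x, HasDerivAt (fun x => u x ^ 2) (2 * (u x * deriv u x)) x := fun x => by
    simpa [mul_assoc] using (hu.1 x).hasDerivAt.fun_pow 2
  have hi := hu.integrable_mul_deriv.const_mul 2
  exact ⟨tendsto_zero_of_sq <| tendsto_zero_of_hasDerivAt_of_integrableOn_Ioi (a := 0)
      (fun x _ => hd x) hi.integrableOn hu.2.1.integrableOn,
    tendsto_zero_of_sq <| tendsto_zero_of_hasDerivAt_of_integrableOn_Iic (a := 0)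
      (fun x _ => hd x) hi.integrableOn hu.2.1.integrableOn⟩

theorem InH1mass.exists_isMax_abs {μ : ℝ} (hμ : 0 < μ) {u : ℝ → ℝ} (hu : InH1mass μ u) :
    ∃ x₀, 0 < |u x₀| ∧ ∀ x, |u x| ≤ |u x₀| := by
  obtain ⟨x₁, hx₁⟩ : ∃ x, u x ≠ 0 := by
    by_contra! h
    have := hu.2.2.2
    simp [h] at this
    exact hμ.ne this
  have hpos : 0 < |u x₁| := abs_pos.2 hx₁
  have hlim : Tendsto (fun x => |u x|) (cocompact ℝ) (𝓝 0) := by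
    rw [cocompact_eq_atBot_atTop]
    exact (tendsto_zero_iff_abs_tendsto_zero u).1 (hu.tendsto_zero.2.sup hu.tendsto_zero.1)
  obtain ⟨x₀, hx₀⟩ := hu.1.continuous.abs.exists_forall_ge' x₁
    ((hlim.eventually_lt_const hpos).mono fun _ h => h.le)
  exact ⟨x₀, hpos.trans_le (hx₀ x₁), hx₀⟩

theorem integrable_sq_mul_comp_abs {V : ℝ → ℝ} (hc : Continuous V) (hm : StrictMonoOn V (Ici 0))
    (h0 : V 0 = 0) {u : ℝ → ℝ} (hu : Continuous u) (hi : Integrable fun x => u x ^ 2) {M : ℝ}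
    (hM : ∀ x, |u x| ≤ M) : Integrable fun x => u x ^ 2 * V |u x| := by
  refine (hi.mul_const (V M)).mono' (by fun_prop) (Eventually.of_forall fun x => ?_)
  have h1 : 0 ≤ V |u x| := h0 ▸ hm.monotoneOn (mem_Ici.2 le_rfl) (mem_Ici.2 (abs_nonneg _))
    (abs_nonneg _)
  have h2 : V |u x| ≤ V M := hm.monotoneOn (mem_Ici.2 (abs_nonneg _))
    (mem_Ici.2 ((abs_nonneg _).trans (hM x))) (hM x)
  rw [Real.norm_eq_abs, abs_of_nonneg (by positivity)]
  gcongr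

/-- Every admissible function has at least the energy of the profile with the same maximum. -/
theorem profileEnergy_le {V : ℝ → ℝ} (hc : Continuous V) (hm : StrictMonoOn V (Ici 0))
    (h0 : V 0 = 0) {μ : ℝ} (hμ : 0 < μ) {u : ℝ → ℝ} (hu : InH1mass μ u) :
    ∃ M, 0 < M ∧ profileEnergy V μ M ≤
      ∫ x, ((1 / 2) * deriv u x ^ 2 - (1 / 2) * (u x ^ 2 * V |u x|)) := by
  obtain ⟨x₀, hpos, hmax⟩ := hu.exists_isMax_abs hμ
  have hcu := hu.1.continuous
  set M := |u x₀| with hM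
  refine ⟨M, hpos, ?_⟩
  have hVi := integrable_sq_mul_comp_abs hc hm h0 hcu hu.2.1 hmax
  set φ : ℝ → ℝ := fun s => |s| * √(V M - V |s|) with hφ
  have hφc : Continuous φ := by fun_prop
  set Φ : ℝ → ℝ := fun s => ∫ r in (0 : ℝ)..s, φ r with hΦ
  have hΦd : ∀ s, HasDerivAt Φ (φ s) s := fun s => (hφc.integral_hasStrictDerivAt 0 s).hasDerivAt
  have hΦ0 : Φ 0 = 0 := by simp [hΦ]
  have hΦM : |Φ (u x₀)| = |solitonAction V M| := by
    have h1 : Φ M = solitonAction V M := by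
      refine intervalIntegral.integral_congr fun s hs => ?_
      rw [uIcc_of_le hpos.le] at hs
      simp only [hφ, abs_of_nonneg hs.1]
    have h2 : ∀ s, Φ (-s) = - Φ s := fun s => by
      have := intervalIntegral.integral_comp_neg (a := 0) (b := s) φ
      have h3 : ∀ r, φ (-r) = φ r := fun r => by simp [hφ]
      simp only [h3, neg_zero] at this
      simp only [hΦ, this]
      rw [intervalIntegral.integral_symm]
    rcases abs_choice (u x₀) with h | h
    · rw [← h1, hM, h]
    · rw [← h1, hM, h, h2, abs_neg]
  set D : ℝ → ℝ := fun x => φ (u x) * deriv u x with hD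
  have hDd : ∀ x, HasDerivAt (fun x => Φ (u x)) (D x) x := fun x =>
    (hΦd (u x)).comp x (hu.1 x).hasDerivAt
  set K : ℝ → ℝ := fun x => ((1 / 2) * deriv u x ^ 2 - (1 / 2) * (u x ^ 2 * V |u x|))
    + V M / 2 * u x ^ 2 with hK
  have hEi : Integrable fun x => (1 / 2) * deriv u x ^ 2 - (1 / 2) * (u x ^ 2 * V |u x|) :=
    (hu.2.2.1.const_mul _).sub (hVi.const_mul _)
  have hKi : Integrable K := hEi.add (hu.2.1.const_mul _)
  have hDK : ∀ x, ‖D x‖ ≤ K x := fun x => by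
    have hV : 0 ≤ V M - V |u x| := sub_nonneg.2 <|
      hm.monotoneOn (mem_Ici.2 (abs_nonneg _)) (mem_Ici.2 hpos.le) (hmax x)
    have hs := Real.sq_sqrt hV
    simp only [hD, hφ, hK, Real.norm_eq_abs, abs_mul, abs_abs, abs_of_nonneg (Real.sqrt_nonneg _)]
    nlinarith [sq_nonneg (|u x| * √(V M - V |u x|) - |deriv u x|), sq_abs (u x),
      sq_abs (deriv u x)]
  have hDi : Integrable D := hKi.mono'
    ((hφc.comp hcu).measurable.mul (measurable_deriv u)).aestronglyMeasurable
    (Eventually.of_forall hDK)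
  have hΦt : Tendsto Φ (𝓝 0) (𝓝 0) := by
    simpa [hΦ0] using (hΦd 0).continuousAt.tendsto
  have hleft := integral_Iic_of_hasDerivAt_of_tendsto' (a := x₀) (fun x _ => hDd x)
    hDi.integrableOn (hΦt.comp hu.tendsto_zero.2)
  have hright := integral_Ioi_of_hasDerivAt_of_tendsto' (a := x₀) (fun x _ => hDd x)
    hDi.integrableOn (hΦt.comp hu.tendsto_zero.1)
  have hbound : ∀ s : Set ℝ, |∫ x in s, D x| ≤ ∫ x in s, K x := fun s =>
    norm_integral_le_of_norm_le hKi.integrableOn (Eventually.of_forall hDK)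
  have h1 := hbound (Iic x₀)
  have h2 := hbound (Ioi x₀)
  rw [hleft, sub_zero, hΦM] at h1
  rw [hright, zero_sub, abs_neg, hΦM] at h2
  have h3 : ∫ x, K x = (∫ x in Iic x₀, K x) + ∫ x in Ioi x₀, K x := by
    rw [← compl_Iic, integral_add_compl measurableSet_Iic hKi]
  have h4 : ∫ x, K x = (∫ x, ((1 / 2) * deriv u x ^ 2 - (1 / 2) * (u x ^ 2 * V |u x|)))
      + V M / 2 * μ := by
    rw [hK, integral_add hEi (hu.2.1.const_mul _), integral_const_mul, hu.2.2.2]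
  have h5 := le_abs_self (solitonAction V M)
  rw [profileEnergy]
  linarith

/-- A minimality condition on the profile energy bounds the mass of the soliton. -/
theorem integral_div_sqrt_le {V : ℝ → ℝ} (hc : Continuous V) (hm : StrictMonoOn V (Ici 0))
    {μ M a : ℝ} (ha : 0 < a) (haM : a < M)
    (hmin : profileEnergy V μ M ≤ profileEnergy V μ a) :
    ∫ s in (0 : ℝ)..a, s / √(V M - V s) ≤ μ / 2 := by
  have hV : 0 < V M - V a := sub_pos.2 (hm (mem_Ici.2 ha.le) (mem_Ici.2 (ha.trans haM).le) haM)
  have hpos : ∀ s ∈ Icc 0 a, 0 < V M - V s ∧ 0 ≤ V a - V s := fun s hs => by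
    have := hm.monotoneOn (mem_Ici.2 hs.1) (mem_Ici.2 ha.le) hs.2
    constructor <;> linarith
  have hcM : Continuous fun s => s * √(V M - V s) := by fun_prop
  have hca : Continuous fun s => s * √(V a - V s) := by fun_prop
  have hint : IntervalIntegrable (fun s => s / √(V M - V s)) volume 0 a := by
    refine ContinuousOn.intervalIntegrable ?_
    rw [uIcc_of_le ha.le]
    exact continuousOn_id.div (by fun_prop) fun s hs => (Real.sqrt_pos.2 (hpos s hs).1).ne'
  have h1 : ∫ s in (0 : ℝ)..a, (V M - V a) / 2 * (s / √(V M - V s)) ≤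
      ∫ s in (0 : ℝ)..a, (s * √(V M - V s) - s * √(V a - V s)) := by
    refine intervalIntegral.integral_mono_on ha.le (hint.const_mul _)
      ((hcM.sub hca).intervalIntegrable _ _) fun s hs => ?_
    obtain ⟨hp, hn⟩ := hpos s hs
    have hp' := Real.sqrt_pos.2 hp
    rw [← mul_div_assoc, div_le_iff₀ hp', ← sub_nonneg]
    have e1 := Real.sq_sqrt hp.le
    have e2 := Real.sq_sqrt hn
    have e3 : (s * √(V M - V s) - s * √(V a - V s)) * √(V M - V s) - (V M - V a) / 2 * s
        = s / 2 * (√(V M - V s) - √(V a - V s)) ^ 2 := by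
      linear_combination s / 2 * e1 - s / 2 * e2
    rw [e3]
    have := hs.1
    positivity
  rw [intervalIntegral.integral_const_mul, intervalIntegral.integral_sub
    (hcM.intervalIntegrable _ _) (hca.intervalIntegrable _ _)] at h1
  have h2 : ∫ s in (0 : ℝ)..a, s * √(V M - V s) ≤ solitonAction V M := by
    refine intervalIntegral.integral_mono_interval le_rfl ha.le haM.le ?_
      (hcM.intervalIntegrable _ _)
    refine (ae_restrict_iff' measurableSet_Ioc).2 (Eventually.of_forall fun s hs => ?_)
    exact mul_nonneg hs.1.le (Real.sqrt_nonneg _)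
  have h3 : solitonAction V a = ∫ s in (0 : ℝ)..a, s * √(V a - V s) := rfl
  simp only [profileEnergy] at hmin
  refine le_of_mul_le_mul_left ?_ hV
  nlinarith

theorem integral_comp_abs_sub_of_eqOn_Iic {G : ℝ → ℝ} {c l : ℝ} (hl : 0 ≤ l)
    (hc : ∀ x ≤ 0, G x = c) (hG : IntegrableOn G (Ioi 0)) :
    Integrable (fun x => G (|x| - l)) ∧
      ∫ x, G (|x| - l) = 2 * (l * c + ∫ x in Ioi 0, G x) := by
  have hI : EqOn G (fun _ => c) (Ioc (-l) 0) := fun x hx => hc x hx.2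
  have hIi : IntegrableOn G (Ioc (-l) 0) :=
    (integrableOn_congr_fun hI measurableSet_Ioc).2 (integrableOn_const (by simp))
  have hunion : Ioc (-l) 0 ∪ Ioi 0 = Ioi (-l) := Ioc_union_Ioi_eq_Ioi (by linarith)
  have hGl : IntegrableOn G (Ioi (-l)) := hunion ▸ hIi.union hG
  have hGs : IntegrableOn (fun x => G (x - l)) (Ioi 0) := by
    have := (measurePreserving_sub_right (volume : Measure ℝ) l).integrableOn_comp_preimage
      (MeasurableEquiv.subRight l).measurableEmbedding (f := G) (s := Ioi (-l))
    simpa [Function.comp_def] using this.2 hGl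
  have hGa : IntegrableOn (fun x => G (|x| - l)) (Ioi 0) :=
    (integrableOn_congr_fun (fun x hx => by simp [abs_of_pos (mem_Ioi.1 hx)])
      measurableSet_Ioi).2 hGs
  constructor
  · rw [← integrableOn_univ, ← Iic_union_Ioi (a := (0 : ℝ))]
    refine IntegrableOn.union ?_ hGa
    have := (Measure.measurePreserving_neg (volume : Measure ℝ)).integrableOn_comp_preimage
      (MeasurableEquiv.neg ℝ).measurableEmbedding (f := fun x => G (|x| - l)) (s := Ici 0)
    simpa [Function.comp_def] using this.2 ((integrableOn_Ici_iff_integrableOn_Ioi).2 hGa)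
  · rw [integral_comp_abs (f := fun x => G (x - l))]
    have h1 : ∫ x in Ioi 0, G (x - l) = ∫ x in Ioi (-l), G x := by
      have := (measurePreserving_sub_right (volume : Measure ℝ) l).setIntegral_preimage_emb
        (MeasurableEquiv.subRight l).measurableEmbedding G (Ioi (-l))
      simpa [Function.comp_def] using this
    rw [h1, ← hunion, setIntegral_union (Set.disjoint_left.2 fun x hx hx' => by
      simp only [mem_Ioi, mem_Ioc] at hx hx'; linarith) measurableSet_Ioi hIi hG,
      setIntegral_congr_fun measurableSet_Ioc hI]
    simp [hl]

/-- The first-order soliton equation has a solution that equals `M` on the negative half-line and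
decreases to zero on the positive one. -/
theorem exists_soliton_halfLine {V : ℝ → ℝ} (hc : Continuous V) (hm : StrictMonoOn V (Ici 0))
    (h0 : V 0 = 0) {M : ℝ} (hM : 0 < M)
    (hint : IntegrableOn (fun s => s / √(V M - V s)) (Ioo 0 M)) :
    ∃ v : ℝ → ℝ, (∀ x ≤ 0, v x = M) ∧ StrictAntiOn v (Ioi 0) ∧ v '' Ioi 0 = Ioo 0 M ∧
      ∀ x, HasDerivAt v (-(v x * √(V M - V (v x)))) x := by
  have hmem : ∀ z : ℝ, 0 < z → M * Real.exp (-z) ∈ Ioo 0 M := fun z hz =>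
    ⟨by positivity, by
      have : Real.exp (-z) < 1 := by simpa using hz
      nlinarith⟩
  have hVlt : ∀ s ∈ Ioo 0 M, 0 < V M - V s := fun s hs =>
    sub_pos.2 (hm (mem_Ici.2 hs.1.le) (mem_Ici.2 hM.le) hs.2)
  have hωpos : 0 < V M := h0 ▸ hm (mem_Ici.2 le_rfl) (mem_Ici.2 hM.le) hM
  set r : ℝ → ℝ := fun z => √(V M - V (M * Real.exp (-|z|))) with hr
  have hrc : Continuous r := by fun_prop
  have hrpos : ∀ z, z ≠ 0 → 0 < r z := fun z hz =>
    Real.sqrt_pos.2 (hVlt _ (hmem _ (abs_pos.2 hz)))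
  have hrle : ∀ z, r z ≤ √(V M) := fun z => by
    refine Real.sqrt_le_sqrt ?_
    have : V 0 ≤ V (M * Real.exp (-|z|)) :=
      hm.monotoneOn (mem_Ici.2 le_rfl) (mem_Ici.2 (by positivity)) (by positivity)
    linarith
  have hsω : 0 < √(V M) := Real.sqrt_pos.2 hωpos
  have himg : (fun z : ℝ => M * Real.exp (-z)) '' Ioi 0 = Ioo 0 M := by
    ext s
    constructor
    · rintro ⟨z, hz, rfl⟩
      exact hmem z hz
    · rintro ⟨h1, h2⟩
      refine ⟨-Real.log (s / M), ?_, ?_⟩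
      · have := Real.log_neg (div_pos h1 hM) ((div_lt_one hM).2 h2)
        simp only [mem_Ioi]; linarith
      · simp only [neg_neg]
        rw [Real.exp_log (div_pos h1 hM)]
        field_simp
  have hki : IntegrableOn (fun z => M ^ 2 * Real.exp (-z) ^ 2 * (r z)⁻¹) (Ioi 0) := by
    have hd : ∀ z ∈ Ioi (0 : ℝ), HasDerivWithinAt (fun z : ℝ => M * Real.exp (-z))
        (-(M * Real.exp (-z))) (Ioi 0) z := fun z _ => by
      have := ((Real.hasDerivAt_exp (-z)).comp z (hasDerivAt_neg z)).const_mul M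
      simpa [Function.comp_def] using this.hasDerivWithinAt
    have hinj : InjOn (fun z : ℝ => M * Real.exp (-z)) (Ioi 0) := fun a _ b _ hab => by
      simpa [hM.ne'] using hab
    have := (integrableOn_image_iff_integrableOn_abs_deriv_smul measurableSet_Ioi hd hinj
      (fun s => s / √(V M - V s))).1 (himg ▸ hint)
    refine (integrableOn_congr_fun (fun z hz => ?_) measurableSet_Ioi).1 this
    simp only [abs_neg, smul_eq_mul, hr, abs_of_pos (mem_Ioi.1 hz),
      abs_of_pos (mul_pos hM (Real.exp_pos _))]
    ring
  have hk0 : ∀ y, 0 ≤ y → IntervalIntegrable (fun z => (r z)⁻¹) volume 0 y := fun y hy => by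
    rw [intervalIntegrable_iff_integrableOn_Ioc_of_le hy]
    refine ((hki.mono_set Ioc_subset_Ioi_self).const_mul ((M ^ 2 * Real.exp (-y) ^ 2)⁻¹)).mono'
      hrc.measurable.inv.aestronglyMeasurable
      ((ae_restrict_iff' measurableSet_Ioc).2 (Eventually.of_forall fun z hz => ?_))
    have h1 := hrpos z hz.1.ne'
    have h2 : Real.exp (-y) ≤ Real.exp (-z) := Real.exp_le_exp.2 (by linarith [hz.2])
    rw [Real.norm_eq_abs, abs_of_pos (inv_pos.2 h1), ← mul_assoc]
    refine le_mul_of_one_le_left (inv_pos.2 h1).le ?_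
    rw [← div_eq_inv_mul, one_le_div (by positivity)]
    gcongr
  have hk : ∀ a b, IntervalIntegrable (fun z => (r z)⁻¹) volume a b := by
    have h1 : ∀ y, IntervalIntegrable (fun z => (r z)⁻¹) volume 0 y := fun y => by
      rcases le_total 0 y with hy | hy
      · exact hk0 y hy
      · have := hk0 (-y) (by linarith)
        rw [IntervalIntegrable.iff_comp_neg] at this
        simpa [hr] using this
    exact fun a b => (h1 a).symm.trans (h1 b)
  set τ : ℝ → ℝ := fun y => ∫ z in (0 : ℝ)..y, (r z)⁻¹ with hτ
  have hτc : Continuous τ := intervalIntegral.continuous_primitive hk 0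
  have hτd : ∀ y, y ≠ 0 → HasDerivAt τ (r y)⁻¹ y := fun y hy =>
    intervalIntegral.integral_hasDerivAt_right (hk 0 y)
      (hrc.measurable.inv.stronglyMeasurable.stronglyMeasurableAtFilter)
      (hrc.continuousAt.inv₀ (hrpos y hy).ne')
  have hτ0 : τ 0 = 0 := by simp [hτ]
  have hτle : ∀ a b, a ≤ b → (b - a) * (√(V M))⁻¹ ≤ τ b - τ a := fun a b hab => by
    rw [hτ, intervalIntegral.integral_interval_sub_left (hk _ _) (hk _ _)]
    have : ∫ z in a..b, (√(V M))⁻¹ ≤ ∫ z in a..b, (r z)⁻¹ := by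
      refine intervalIntegral.integral_mono_ae hab (by simp) (hk a b) ?_
      have : ∀ᵐ z : ℝ, z ≠ 0 := by simp [ae_iff]
      filter_upwards [this] with z hz
      exact inv_anti₀ (hrpos z hz) (hrle z)
    simpa using this
  have hτm : StrictMono τ := fun a b hab => by
    have := hτle a b hab.le
    have h2 : 0 < (b - a) * (√(V M))⁻¹ := mul_pos (by linarith) (by positivity)
    linarith
  have hτs : Function.Surjective τ := by
    refine hτc.surjective ?_ ?_
    · refine tendsto_atTop_mono' _ ?_ (tendsto_id.atTop_mul_const (inv_pos.2 hsω))
      filter_upwards [eventually_ge_atTop 0] with y hy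
      have := hτle 0 y hy
      simp only [hτ0, sub_zero] at this
      exact this
    · refine tendsto_atBot_mono' _ ?_ (tendsto_id.atBot_mul_const (inv_pos.2 hsω))
      filter_upwards [eventually_le_atBot 0] with y hy
      have := hτle y 0 hy
      simp only [hτ0, zero_sub] at this
      simp only [id]
      linarith
  set e := hτm.orderIsoOfSurjective τ hτs
  have hee : ∀ x, τ (e.symm x) = x := fun x => e.apply_symm_apply x
  have hec : Continuous e.symm := e.symm.continuous
  have he0 : e.symm 0 = 0 := by
    rw [OrderIso.symm_apply_eq]; exact hτ0.symm
  have hed : ∀ x, 0 < x → HasDerivAt e.symm (r (e.symm x)) x := fun x hx => by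
    have hne : e.symm x ≠ 0 := by
      rw [← he0]
      exact e.symm.injective.ne hx.ne'
    have := HasDerivAt.of_local_left_inverse hec.continuousAt (hτd _ hne)
      (inv_pos.2 (hrpos _ hne)).ne' (Eventually.of_forall hee)
    simpa using this
  have hepos : ∀ x, 0 < x → 0 < e.symm x := fun x hx => by
    rw [← he0]; exact e.symm.strictMono hx
  set v : ℝ → ℝ := fun x => M * Real.exp (-(e.symm (max x 0))) with hv
  have hvc : Continuous v := by fun_prop
  have hvneg : ∀ x ≤ 0, v x = M := fun x hx => by
    simp only [hv, max_eq_right hx, he0, neg_zero, Real.exp_zero, mul_one]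
  have hvpos : EqOn v (fun x => M * Real.exp (-(e.symm x))) (Ioi 0) := fun x hx => by
    simp only [hv, max_eq_left (mem_Ioi.1 hx).le]
  refine ⟨v, hvneg, ?_, ?_, ?_⟩
  · intro a ha b hb hab
    rw [hvpos ha, hvpos hb]
    have := e.symm.strictMono hab
    simp only
    gcongr
  · rw [hvpos.image_eq, ← himg]
    ext s
    constructor
    · rintro ⟨x, hx, rfl⟩
      exact ⟨e.symm x, hepos x hx, rfl⟩
    · rintro ⟨z, hz, rfl⟩
      refine ⟨e z, ?_, by simp⟩
      have := e.strictMono (mem_Ioi.1 hz)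
      rw [← he0] at this
      simpa using this
  · refine hasDerivAt_of_hasDerivAt_of_ne' (x := 0) (fun x hx => ?_) hvc.continuousAt ?_
    · rcases lt_or_gt_of_ne hx with hx | hx
      · rw [hvneg x hx.le]
        simp only [sub_self, Real.sqrt_zero, mul_zero, neg_zero]
        refine (hasDerivAt_const x M).congr_of_eventuallyEq ?_
        filter_upwards [Iio_mem_nhds hx] with y hy using hvneg y (le_of_lt hy)
      · have h1 := ((hed x hx).neg.exp.const_mul M).congr_of_eventuallyEq
          (f₁ := v) (by filter_upwards [Ioi_mem_nhds hx] with y hy using hvpos hy)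
        convert h1 using 1
        rw [hvpos hx]
        simp only [hr, abs_of_pos (hepos x hx), Pi.neg_apply]
        ring
    · fun_prop

/-- If the soliton of maximum `M` has mass at most `μ`, then inserting a plateau at height `M`
gives an admissible function with the profile energy. -/
theorem exists_energy_eq_profileEnergy {V : ℝ → ℝ} (hc : Continuous V)
    (hm : StrictMonoOn V (Ici 0)) (h0 : V 0 = 0) {μ M : ℝ} (hM : 0 < M)
    (hint : IntegrableOn (fun s => s / √(V M - V s)) (Ioo 0 M))
    (hle : ∫ s in Ioo 0 M, s / √(V M - V s) ≤ μ / 2) :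
    ∃ u, InH1mass μ u ∧
      ∫ x, ((1 / 2) * deriv u x ^ 2 - (1 / 2) * (u x ^ 2 * V |u x|)) = profileEnergy V μ M := by
  obtain ⟨v, hneg, hanti, himg, hd⟩ := exists_soliton_halfLine hc hm h0 hM hint
  have hmem : ∀ x ∈ Ioi (0 : ℝ), v x ∈ Ioo 0 M := fun x hx => himg ▸ mem_image_of_mem v hx
  have hVlt : ∀ s ∈ Ioo 0 M, 0 < V M - V s := fun s hs =>
    sub_pos.2 (hm (mem_Ici.2 hs.1.le) (mem_Ici.2 hM.le) hs.2)
  have habs : ∀ x ∈ Ioi (0 : ℝ), |-(v x * √(V M - V (v x)))| = v x * √(V M - V (v x)) :=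
    fun x hx => by rw [abs_neg, abs_of_pos (mul_pos (hmem x hx).1
      (Real.sqrt_pos.2 (hVlt _ (hmem x hx))))]
  have hchange := fun g : ℝ → ℝ => integral_image_eq_integral_abs_deriv_smul measurableSet_Ioi
    (fun x _ => (hd x).hasDerivWithinAt) hanti.injOn g
  have hchangei := fun g : ℝ → ℝ => integrableOn_image_iff_integrableOn_abs_deriv_smul
    measurableSet_Ioi (fun x _ => (hd x).hasDerivWithinAt) hanti.injOn g
  rw [himg] at hchange hchangei
  have hmass : EqOn (fun x => |-(v x * √(V M - V (v x)))| • (v x / √(V M - V (v x))))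
      (fun x => v x ^ 2) (Ioi 0) := fun x hx => by
    have := Real.sqrt_pos.2 (hVlt _ (hmem x hx))
    simp only [habs x hx, smul_eq_mul]
    field_simp
  have hkin : EqOn (fun x => |-(v x * √(V M - V (v x)))| • (v x * √(V M - V (v x))))
      (fun x => (-(v x * √(V M - V (v x)))) ^ 2) (Ioi 0) := fun x hx => by
    simp only [habs x hx, smul_eq_mul]
    ring
  have hmi : IntegrableOn (fun x => v x ^ 2) (Ioi 0) :=
    (integrableOn_congr_fun hmass measurableSet_Ioi).1 ((hchangei fun s => s / √(V M - V s)).1 hint)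
  have hm_eq := (hchange fun s => s / √(V M - V s)).trans (setIntegral_congr_fun measurableSet_Ioi hmass)
  have hact : Continuous fun s => s * √(V M - V s) := by fun_prop
  have hai : IntegrableOn (fun s => s * √(V M - V s)) (Ioo 0 M) :=
    (hact.continuousOn.integrableOn_Icc (a := 0) (b := M)).mono_set Ioo_subset_Icc_self
  have hkini : IntegrableOn (fun x => (-(v x * √(V M - V (v x)))) ^ 2) (Ioi 0) :=
    (integrableOn_congr_fun hkin measurableSet_Ioi).1 ((hchangei fun s => s * √(V M - V s)).1 hai)
  have hk_eq := (hchange fun s => s * √(V M - V s)).trans (setIntegral_congr_fun measurableSet_Ioi hkin)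
  have hact_eq : ∫ s in Ioo 0 M, s * √(V M - V s) = solitonAction V M := by
    rw [solitonAction, intervalIntegral.integral_of_le hM.le, integral_Ioc_eq_integral_Ioo]
  set l := (μ / 2 - ∫ x in Ioi 0, v x ^ 2) / M ^ 2 with hl
  have hl0 : 0 ≤ l := div_nonneg (by rw [← hm_eq]; linarith) (by positivity)
  obtain ⟨hMi, hMe⟩ := integral_comp_abs_sub_of_eqOn_Iic (G := fun x => v x ^ 2) (c := M ^ 2) hl0
    (fun x hx => by rw [hneg x hx]) hmi
  obtain ⟨hKi, hKe⟩ := integral_comp_abs_sub_of_eqOn_Iic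
    (G := fun x => (-(v x * √(V M - V (v x)))) ^ 2) (c := 0) hl0
    (fun x hx => by simp [hneg x hx]) hkini
  set u : ℝ → ℝ := fun x => v (x - l) + v (-x - l) - M with hu
  have hud : ∀ x, HasDerivAt u (-(v (x - l) * √(V M - V (v (x - l)))) +
      v (-x - l) * √(V M - V (v (-x - l)))) x := fun x => by
    have h1 := (hd (x - l)).comp x ((hasDerivAt_id x).sub_const l)
    have h2 := (hd (-x - l)).comp x ((hasDerivAt_neg x).sub_const l)
    refine ((h1.add h2).sub_const M).congr_deriv ?_
    ring
  have hu1 : ∀ x, u x = v (|x| - l) := fun x => by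
    rcases le_total 0 x with hx | hx
    · simp [hu, abs_of_nonneg hx, hneg (-x - l) (by linarith)]
    · simp [hu, abs_of_nonpos hx, hneg (x - l) (by linarith)]
  have hu2 : ∀ x, deriv u x ^ 2 = (-(v (|x| - l) * √(V M - V (v (|x| - l))))) ^ 2 := fun x => by
    rw [(hud x).deriv]
    rcases le_total 0 x with hx | hx
    · simp [abs_of_nonneg hx, hneg (-x - l) (by linarith)]
    · simp [abs_of_nonpos hx, hneg (x - l) (by linarith)]
  have hvmem : ∀ x, 0 < v x ∧ v x ≤ M := fun x => by
    rcases le_or_gt x 0 with hx | hx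
    · rw [hneg x hx]; exact ⟨hM, le_rfl⟩
    · exact ⟨(hmem x hx).1, (hmem x hx).2.le⟩
  have hU2 : Integrable fun x => u x ^ 2 := by simpa only [hu1] using hMi
  have hD2 : Integrable fun x => deriv u x ^ 2 := by simpa only [hu2] using hKi
  have hmassU : ∫ x, u x ^ 2 = μ := by
    simp only [hu1]
    rw [hMe, hl]
    field_simp
    ring
  refine ⟨u, ⟨fun x => (hud x).differentiableAt, hU2, hD2, hmassU⟩, ?_⟩
  have hkinU : ∫ x, deriv u x ^ 2 = 2 * solitonAction V M := by
    simp only [hu2]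
    rw [hKe, ← hk_eq, hact_eq]
    ring
  have hpt : ∀ x, (1 / 2) * deriv u x ^ 2 - (1 / 2) * (u x ^ 2 * V |u x|) =
      deriv u x ^ 2 - V M / 2 * u x ^ 2 := fun x => by
    obtain ⟨h1, h2⟩ := hvmem (|x| - l)
    have hV : 0 ≤ V M - V (v (|x| - l)) :=
      sub_nonneg.2 (hm.monotoneOn (mem_Ici.2 h1.le) (mem_Ici.2 hM.le) h2)
    rw [hu2, hu1, abs_of_pos h1, neg_sq, mul_pow, Real.sq_sqrt hV]
    ring
  simp only [hpt]
  rw [integral_sub hD2 (hU2.const_mul _), integral_const_mul, hkinU, hmassU, profileEnergy]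
  ring

theorem integrableOn_Ioo_of_forall_intervalIntegral_le {h : ℝ → ℝ} {M C : ℝ} (hM : 0 < M)
    (hnn : ∀ s ∈ Ioo 0 M, 0 ≤ h s) (hi : ∀ a ∈ Ioo 0 M, IntegrableOn h (Ioc 0 a))
    (hle : ∀ a ∈ Ioo 0 M, ∫ s in (0 : ℝ)..a, h s ≤ C) :
    IntegrableOn h (Ioo 0 M) ∧ ∫ s in Ioo 0 M, h s ≤ C := by
  obtain ⟨b, -, hb, hbt⟩ := exists_seq_strictMono_tendsto' hM
  have hint : IntegrableOn h (Ioc 0 M) := by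
    refine integrableOn_Ioc_of_intervalIntegral_norm_bounded_right (I := C)
      (fun n => hi _ (hb n)) hbt (Eventually.of_forall fun n => ?_)
    have : ∫ s in Ioc 0 (b n), ‖h s‖ = ∫ s in Ioc 0 (b n), h s :=
      setIntegral_congr_fun measurableSet_Ioc fun s hs =>
        Real.norm_of_nonneg (hnn s ⟨hs.1, hs.2.trans_lt (hb n).2⟩)
    rw [this, ← intervalIntegral.integral_of_le (hb n).1.le]
    exact hle _ (hb n)
  refine ⟨hint.mono_set Ioo_subset_Ioc_self, ?_⟩
  rw [← integral_Ioc_eq_integral_Ioo, ← intervalIntegral.integral_of_le hM.le]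
  have hcont := intervalIntegral.continuousOn_primitive_interval (μ := volume) (f := h)
    (a := 0) (b := M) (by
      rw [uIcc_of_le hM.le]; exact (integrableOn_Icc_iff_integrableOn_Ioc).2 hint)
  rw [uIcc_of_le hM.le] at hcont
  have ht := (hcont M (right_mem_Icc.2 hM.le)).tendsto.comp
    (tendsto_nhdsWithin_iff.2 ⟨hbt, Eventually.of_forall fun n => Ioo_subset_Icc_self (hb n)⟩)
  exact le_of_tendsto ht (Eventually.of_forall fun n => hle _ (hb n))

theorem continuous_profileEnergy {V : ℝ → ℝ} (hc : Continuous V) (μ : ℝ) :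
    Continuous (profileEnergy V μ) := by
  have : Continuous (solitonAction V) :=
    intervalIntegral.continuous_parametric_intervalIntegral_of_continuous
      (f := fun M s => s * √(V M - V s)) (s := id) (by fun_prop) continuous_id
  unfold profileEnergy
  fun_prop

/-- Once the profile energy is negative somewhere and nonnegative for large maxima, the reduced
energy has a minimizer of any given mass. -/
theorem exists_minimizer_of_profileEnergy {V : ℝ → ℝ} (hc : Continuous V)
    (hm : StrictMonoOn V (Ici 0)) (h0 : V 0 = 0) {μ R m : ℝ} (hμ : 0 < μ) (hm0 : 0 < m)
    (hneg : profileEnergy V μ m < 0) (hR : ∀ M, R ≤ M → 0 ≤ profileEnergy V μ M) :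
    ∃ u, InH1mass μ u ∧
      ∫ x, ((1 / 2) * deriv u x ^ 2 - (1 / 2) * (u x ^ 2 * V |u x|)) < 0 ∧
      ∀ w, InH1mass μ w →
        ∫ x, ((1 / 2) * deriv u x ^ 2 - (1 / 2) * (u x ^ 2 * V |u x|)) ≤
          ∫ x, ((1 / 2) * deriv w x ^ 2 - (1 / 2) * (w x ^ 2 * V |w x|)) := by
  have hmR : m < R := by
    by_contra! h
    exact (hR m h).not_gt hneg
  obtain ⟨M, hMmem, hMmin⟩ := isCompact_Icc.exists_isMinOn (s := Icc 0 R)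
    ⟨m, hm0.le, hmR.le⟩ (continuous_profileEnergy hc μ).continuousOn
  have hMneg : profileEnergy V μ M < 0 := (hMmin ⟨hm0.le, hmR.le⟩).trans_lt hneg
  have hM : 0 < M := by
    refine hMmem.1.lt_of_ne fun h => ?_
    rw [← h] at hMneg
    simp [profileEnergy, solitonAction, h0] at hMneg
  have hmin : ∀ N, 0 < N → profileEnergy V μ M ≤ profileEnergy V μ N := fun N hN => by
    rcases le_total N R with h | h
    · exact hMmin ⟨hN.le, h⟩
    · exact hMneg.le.trans (hR N h)
  obtain ⟨hint, hle⟩ := integrableOn_Ioo_of_forall_intervalIntegral_le hM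
    (h := fun s => s / √(V M - V s)) (C := μ / 2)
    (fun s hs => div_nonneg hs.1.le (Real.sqrt_nonneg _))
    (fun a ha => by
      refine (ContinuousOn.integrableOn_Icc ?_).mono_set Ioc_subset_Icc_self
      refine continuousOn_id.div (by fun_prop) fun s hs => (Real.sqrt_pos.2 (sub_pos.2 ?_)).ne'
      exact hm (mem_Ici.2 hs.1) (mem_Ici.2 hM.le) (hs.2.trans_lt ha.2))
    (fun a ha => integral_div_sqrt_le hc hm ha.1 ha.2 (hmin a ha.1))
  obtain ⟨u, hu, hue⟩ := exists_energy_eq_profileEnergy hc hm h0 hM hint hle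
  refine ⟨u, hu, hue ▸ hMneg, fun w hw => ?_⟩
  obtain ⟨N, hN, hNle⟩ := profileEnergy_le hc hm h0 hμ hw
  rw [hue]
  exact (hmin N hN).trans hNle

/-- The potential `2 F(s) / s ^ 2` of the combined nonlinearity
`F(s) = |s| ^ p / p + α |s| ^ q / q`. -/
noncomputable def combinedPotential (p q α s : ℝ) : ℝ :=
  2 / p * |s| ^ (p - 2) + 2 * α / q * |s| ^ (q - 2)

theorem continuous_combinedPotential {p q : ℝ} (α : ℝ) (hq : 2 < q) (hp : 2 < p) :
    Continuous (combinedPotential p q α) := by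
  have h1 : Continuous fun s : ℝ => |s| ^ (p - 2) :=
    continuous_abs.rpow_const fun _ => Or.inr (by linarith)
  have h2 : Continuous fun s : ℝ => |s| ^ (q - 2) :=
    continuous_abs.rpow_const fun _ => Or.inr (by linarith)
  unfold combinedPotential
  fun_prop

theorem strictMonoOn_combinedPotential {p q α : ℝ} (hq : 2 < q) (hp : 2 < p) (hα : 0 < α) :
    StrictMonoOn (combinedPotential p q α) (Ici 0) := fun a ha b hb hab => by
  simp only [combinedPotential, abs_of_nonneg (mem_Ici.1 ha), abs_of_nonneg (mem_Ici.1 hb)]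
  have h1 := Real.rpow_lt_rpow (mem_Ici.1 ha) hab (show 0 < p - 2 by linarith)
  have h2 := Real.rpow_lt_rpow (mem_Ici.1 ha) hab (show 0 < q - 2 by linarith)
  gcongr

theorem combinedPotential_zero {p q : ℝ} (α : ℝ) (hq : 2 < q) (hp : 2 < p) :
    combinedPotential p q α 0 = 0 := by
  simp [combinedPotential, Real.zero_rpow (show p - 2 ≠ 0 by linarith),
    Real.zero_rpow (show q - 2 ≠ 0 by linarith)]

theorem NLSenergy_eq {p q : ℝ} (α : ℝ) (hq : 2 < q) (hp : 2 < p) (u : ℝ → ℝ) :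
    NLSenergy p q α u =
      ∫ x, ((1 / 2) * deriv u x ^ 2 - (1 / 2) * (u x ^ 2 * combinedPotential p q α |u x|)) := by
  have hpow : ∀ r : ℝ, 2 < r → ∀ s : ℝ, |s| ^ r = s ^ 2 * |s| ^ (r - 2) := fun r hr s => by
    rw [← sq_abs, ← Real.rpow_two, ← Real.rpow_add' (abs_nonneg _) (by linarith)]
    congr 1
    ring
  unfold NLSenergy
  congr 1 with x
  rw [hpow p hp, hpow q hq, combinedPotential, abs_abs]
  ring

theorem exists_profileEnergy_neg {p q α μ : ℝ} (hq : 2 < q) (hp : 2 < p) (hq6 : q < 6)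
    (hα : 0 < α) (hμ : 0 < μ) :
    ∃ m, 0 < m ∧ profileEnergy (combinedPotential p q α) μ m < 0 := by
  set V := combinedPotential p q α with hV
  have hc : Continuous V := continuous_combinedPotential α hq hp
  have hm : StrictMonoOn V (Ici 0) := strictMonoOn_combinedPotential hq hp hα
  have h0 : V 0 = 0 := combinedPotential_zero α hq hp
  set c := α * μ ^ 2 / (2 * q) with hcdef
  have hcpos : 0 < c := by positivity
  set m := (c / 2) ^ (1 / (6 - q)) with hmdef
  have hmpos : 0 < m := by positivity
  have hmpow : m ^ (6 - q) < c := by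
    rw [hmdef, ← Real.rpow_mul (by positivity), one_div_mul_cancel (by linarith), Real.rpow_one]
    linarith
  have hm4 : m ^ 4 = m ^ (6 - q) * m ^ (q - 2) := by
    rw [← Real.rpow_add hmpos, ← Real.rpow_natCast]
    congr 1
    push_cast
    ring
  have hVm : 4 * m ^ 4 < V m * μ ^ 2 := by
    have h1 : 0 < m ^ (q - 2) := by positivity
    have h2 : 0 ≤ m ^ (p - 2) := by positivity
    have h3 : 2 * α / q * m ^ (q - 2) ≤ V m := by
      simp only [hV, combinedPotential, abs_of_pos hmpos]
      have : 0 ≤ 2 / p * m ^ (p - 2) := by positivity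
      linarith
    have h4 : c * m ^ (q - 2) * 4 = 2 * α / q * m ^ (q - 2) * μ ^ 2 := by
      rw [hcdef]; field_simp; ring
    have h5 := mul_lt_mul_of_pos_right hmpow h1
    have h6 := mul_le_mul_of_nonneg_right h3 (sq_nonneg μ)
    rw [hm4]
    linarith
  have hVpos : 0 < V m := h0 ▸ hm (mem_Ici.2 le_rfl) (mem_Ici.2 hmpos.le) hmpos
  have hJ : solitonAction V m ≤ √(V m) * (m ^ 2 / 2) := by
    have h1 : solitonAction V m ≤ ∫ s in (0 : ℝ)..m, √(V m) * s := by
      refine intervalIntegral.integral_mono_on hmpos.le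
        (Continuous.intervalIntegrable (by fun_prop) _ _)
        (Continuous.intervalIntegrable (by fun_prop) _ _) fun s hs => ?_
      rw [mul_comm]
      refine mul_le_mul_of_nonneg_right (Real.sqrt_le_sqrt ?_) hs.1
      have := hm.monotoneOn (mem_Ici.2 le_rfl) (mem_Ici.2 hs.1) hs.1
      linarith
    rw [intervalIntegral.integral_const_mul, integral_id] at h1
    simpa using h1
  refine ⟨m, hmpos, ?_⟩
  have hs := Real.sq_sqrt hVpos.le
  have hsp := Real.sqrt_pos.2 hVpos
  have h7 : 2 * m ^ 2 < √(V m) * μ := by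
    refine lt_of_pow_lt_pow_left₀ 2 (by positivity) ?_
    rw [mul_pow, mul_pow, hs]
    linarith
  rw [profileEnergy]
  nlinarith

theorem integral_mul_sqrt_one_sub_rpow_pos {r : ℝ} (hr : 0 < r) :
    0 < ∫ t in (0 : ℝ)..1, t * √(1 - t ^ r) := by
  have hc : Continuous fun t : ℝ => t * √(1 - t ^ r) := by
    have : Continuous fun t : ℝ => t ^ r := Real.continuous_rpow_const hr.le
    fun_prop
  refine intervalIntegral.intervalIntegral_pos_of_pos_on (hc.intervalIntegrable _ _)
    (fun t ht => mul_pos ht.1 (Real.sqrt_pos.2 ?_)) one_pos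
  linarith [Real.rpow_lt_one ht.1.le ht.2 hr]

theorem integral_mul_sqrt_one_sub_pow_four :
    ∫ t in (0 : ℝ)..1, t * √(1 - t ^ (4 : ℝ)) = Real.pi / 8 := by
  have h1 : ∫ t in (0 : ℝ)..1, √(1 - t ^ 2) = Real.pi / 4 := by
    have h := integral_sqrt_one_sub_sq
    have hi : ∀ a b : ℝ, IntervalIntegrable (fun t : ℝ => √(1 - t ^ 2)) volume a b := fun a b =>
      Continuous.intervalIntegrable (by fun_prop) _ _
    rw [← intervalIntegral.integral_add_adjacent_intervals (hi (-1) 0) (hi 0 1)] at h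
    have h2 := intervalIntegral.integral_comp_neg (a := 0) (b := 1) fun t : ℝ => √(1 - t ^ 2)
    simp only [neg_sq, neg_zero] at h2
    rw [← h2] at h
    linarith
  have h2 := intervalIntegral.integral_comp_mul_deriv (a := 0) (b := 1) (f := fun t : ℝ => t ^ 2)
    (f' := fun t => 2 * t) (g := fun t => √(1 - t ^ 2))
    (fun t _ => by simpa using hasDerivAt_pow 2 t) (by fun_prop) (by fun_prop)
  norm_num [h1] at h2
  have h3 : ∀ t : ℝ, √(1 - (t ^ 2) ^ 2) * (2 * t) = 2 * (t * √(1 - t ^ (4 : ℝ))) := fun t => by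
    rw [← pow_mul, show (4 : ℝ) = ((4 : ℕ) : ℝ) by norm_num, Real.rpow_natCast]
    ring
  simp only [h3, intervalIntegral.integral_const_mul] at h2
  linarith

theorem le_solitonAction_combinedPotential {p q α M : ℝ} (hq : 2 < q) (hp : 2 < p) (hα : 0 < α)
    (hM : 0 < M) :
    √(2 / p) * (∫ t in (0 : ℝ)..1, t * √(1 - t ^ (p - 2))) * M ^ ((p + 2) / 2) ≤
      solitonAction (combinedPotential p q α) M := by
  set V := combinedPotential p q α with hV
  have hc : Continuous V := continuous_combinedPotential α hq hp
  have hcr : Continuous fun t : ℝ => t ^ (p - 2) := Real.continuous_rpow_const (by linarith)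
  have h1 := intervalIntegral.mul_integral_comp_mul_left (a := 0) (b := 1) M
    (f := fun s => s * √(V M - V s))
  rw [mul_zero, mul_one] at h1
  rw [solitonAction, ← h1, ← intervalIntegral.integral_const_mul,
    ← intervalIntegral.integral_mul_const, ← intervalIntegral.integral_const_mul]
  refine intervalIntegral.integral_mono_on zero_le_one
    (Continuous.intervalIntegrable (by fun_prop) _ _)
    (Continuous.intervalIntegrable (by fun_prop) _ _) fun t ht => ?_
  have ht1 : 0 ≤ 1 - t ^ (p - 2) := by
    linarith [Real.rpow_le_one ht.1 ht.2 (show 0 ≤ p - 2 by linarith)]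
  have ht2 : 0 ≤ 1 - t ^ (q - 2) := by
    linarith [Real.rpow_le_one ht.1 ht.2 (show 0 ≤ q - 2 by linarith)]
  have hMp : M ^ ((p + 2) / 2) = M * M * √(M ^ (p - 2)) := by
    rw [Real.sqrt_eq_rpow, ← Real.rpow_mul hM.le, ← pow_two, ← Real.rpow_two, ← Real.rpow_add hM]
    congr 1
    ring
  have hle : 2 / p * (M ^ (p - 2) * (1 - t ^ (p - 2))) ≤ V M - V (M * t) := by
    simp only [hV, combinedPotential, abs_of_pos hM, abs_of_nonneg (mul_nonneg hM.le ht.1),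
      Real.mul_rpow hM.le ht.1]
    have : 0 ≤ 2 * α / q * (M ^ (q - 2) * (1 - t ^ (q - 2))) := by positivity
    linarith
  have hsq := Real.sqrt_le_sqrt hle
  rw [Real.sqrt_mul (by positivity), Real.sqrt_mul (by positivity)] at hsq
  calc √(2 / p) * (t * √(1 - t ^ (p - 2))) * M ^ ((p + 2) / 2)
      = M * (M * t * (√(2 / p) * (√(M ^ (p - 2)) * √(1 - t ^ (p - 2))))) := by rw [hMp]; ring
    _ ≤ M * (M * t * √(V M - V (M * t))) := by
      have := ht.1
      gcongr

theorem eventually_mul_rpow_le_mul_rpow {a b c d : ℝ} (hab : a < b) (hd : 0 < d) :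
    ∀ᶠ M : ℝ in atTop, c * M ^ a ≤ d * M ^ b := by
  have h := tendsto_rpow_atTop (sub_pos.2 hab)
  filter_upwards [h.eventually_ge_atTop (c / d), eventually_gt_atTop 0] with M hM hpos
  have h1 : M ^ b = M ^ (b - a) * M ^ a := by
    rw [← Real.rpow_add hpos, sub_add_cancel]
  have h2 : 0 < M ^ a := by positivity
  rw [div_le_iff₀ hd] at hM
  rw [h1]
  nlinarith

theorem eventually_profileEnergy_nonneg {p q α μ : ℝ} (hq : 2 < q) (hqp : q < p) (hα : 0 < α)
    (hcase : (p < 6 ∧ 0 < μ) ∨ (p = 6 ∧ 0 < μ ∧ μ < muR)) :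
    ∀ᶠ M in atTop, 0 ≤ profileEnergy (combinedPotential p q α) μ M := by
  set k := 2 * √(2 / p) * ∫ t in (0 : ℝ)..1, t * √(1 - t ^ (p - 2)) with hk
  have hp : 2 < p := hq.trans hqp
  have hkpos : 0 < k := mul_pos (by positivity) (integral_mul_sqrt_one_sub_rpow_pos (by linarith))
  have hlow : ∀ M, 0 < M → k * M ^ ((p + 2) / 2) - μ / p * M ^ (p - 2) - α * μ / q * M ^ (q - 2) ≤
      profileEnergy (combinedPotential p q α) μ M := fun M hM => by
    have := le_solitonAction_combinedPotential hq hp hα hM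
    have h2 : combinedPotential p q α M * (μ / 2) =
        μ / p * M ^ (p - 2) + α * μ / q * M ^ (q - 2) := by
      rw [combinedPotential, abs_of_pos hM]; ring
    rw [profileEnergy, h2, hk]
    linarith
  rcases hcase with ⟨hp6, -⟩ | ⟨rfl, -, hμ⟩
  · filter_upwards [eventually_gt_atTop 0,
      eventually_mul_rpow_le_mul_rpow (c := μ / p) (show p - 2 < (p + 2) / 2 by linarith)
        (half_pos hkpos),
      eventually_mul_rpow_le_mul_rpow (c := α * μ / q) (show q - 2 < (p + 2) / 2 by linarith)
        (half_pos hkpos)] with M h0 h1 h2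
    linarith [hlow M h0]
  · have hk6 : 0 < k - μ / 6 := by
      have h3 : √(2 / 6 : ℝ) = √3 / 3 := by
        rw [Real.sqrt_eq_iff_mul_self_eq (by norm_num) (by positivity)]
        nlinarith [Real.mul_self_sqrt (show (0 : ℝ) ≤ 3 by norm_num)]
      rw [hk, h3, show (6 : ℝ) - 2 = 4 by norm_num, integral_mul_sqrt_one_sub_pow_four]
      rw [muR] at hμ
      linarith
    filter_upwards [eventually_gt_atTop 0,
      eventually_mul_rpow_le_mul_rpow (c := α * μ / q) (show q - 2 < (4 : ℝ) by linarith)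
        hk6] with M h0 h1
    have := hlow M h0
    norm_num at this
    norm_num at h1
    linarith

/-- focusing case, negativity of the ground-state level and
existence of a ground state. -/
theorem focusing_existence_ground_state
    (p q α μ : ℝ) (hq : 2 < q) (hqp : q < p) (hp : p ≤ 6) (hα : 0 < α)
    (hcase : (p < 6 ∧ 0 < μ) ∨ (p = 6 ∧ 0 < μ ∧ μ < muR)) :
    ⊥ < groundLevel p q α μ ∧ groundLevel p q α μ < 0 ∧
    ∃ u : ℝ → ℝ, InH1mass μ u ∧
      ((NLSenergy p q α u : ℝ) : EReal) = groundLevel p q α μ := by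
  have hμ : 0 < μ := by
    rcases hcase with h | h
    exacts [h.2, h.2.1]
  have hp2 : 2 < p := hq.trans hqp
  obtain ⟨R, hR⟩ := eventually_atTop.1 (eventually_profileEnergy_nonneg hq hqp hα hcase)
  obtain ⟨m, hm, hneg⟩ := exists_profileEnergy_neg hq hp2 (hqp.trans_le hp) hα hμ
  obtain ⟨u, hu, huneg, humin⟩ := exists_minimizer_of_profileEnergy
    (continuous_combinedPotential α hq hp2) (strictMonoOn_combinedPotential hq hp2 hα)
    (combinedPotential_zero α hq hp2) hμ hm hneg hR
  simp only [← NLSenergy_eq α hq hp2] at huneg humin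
  have hlevel : groundLevel p q α μ = ((NLSenergy p q α u : ℝ) : EReal) := by
    refine le_antisymm (sInf_le ⟨u, hu, rfl⟩) (le_sInf ?_)
    rintro _ ⟨w, hw, rfl⟩
    exact EReal.coe_le_coe_iff.2 (humin w hw)
  rw [hlevel]
  exact ⟨EReal.bot_lt_coe _, by exact_mod_cast huneg, u, hu, rfl⟩
end

section
/- Let 2 < q < p ≤ 6, α < 0, ν > 0 and θ ≥ 1; if p = 6 assume additionally θν ≤ μ_ℝ. Then 𝓔_{p,q,α}(θν) ≤ θ^{p/2} 𝓔_{p,q,α}(ν), both ground-state levels being finite. -/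
open MeasureTheory

namespace InH1mass

variable {μ : ℝ} {u : ℝ → ℝ}

lemma integrable_mul_deriv_s13 (h : InH1mass μ u) : Integrable fun x => u x * deriv u x := by
  obtain ⟨hd, h1, h2, -⟩ := h
  refine (h1.add h2).mono'
    (hd.continuous.measurable.mul (measurable_deriv u)).aestronglyMeasurable
    (.of_forall fun x => ?_)
  simp only [Pi.add_apply, Real.norm_eq_abs]
  rw [abs_le]
  constructor <;> nlinarith [sq_nonneg (u x + deriv u x), sq_nonneg (u x - deriv u x),
    sq_nonneg (u x), sq_nonneg (deriv u x)]

lemma exists_abs_le (h : InH1mass μ u) : ∃ B, 0 < B ∧ ∀ x, |u x| ≤ B := by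
  have hi : Integrable fun x => 2 * (u x * deriv u x) := h.integrable_mul_deriv_s13.const_mul 2
  have hder : ∀ x, HasDerivAt (fun y => u y ^ 2) (2 * (u x * deriv u x)) x := fun x =>
    ((h.1 x).hasDerivAt.fun_pow 2).congr_deriv (by push_cast; ring)
  set K := ∫ x, ‖2 * (u x * deriv u x)‖
  have hK : 0 ≤ K := integral_nonneg fun x => norm_nonneg _
  refine ⟨K + 1, by linarith, fun x => ?_⟩
  have hlim : Filter.Tendsto (fun y => u y ^ 2) Filter.atBot (nhds 0) :=
    tendsto_zero_of_hasDerivAt_of_integrableOn_Iic (a := x) (fun y _ => hder y)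
      hi.integrableOn h.2.1.integrableOn
  have heq := integral_Iic_of_hasDerivAt_of_tendsto' (a := x) (fun y _ => hder y)
    hi.integrableOn hlim
  have hle : u x ^ 2 ≤ K := by
    calc u x ^ 2 = ∫ y in Set.Iic x, 2 * (u y * deriv u y) := by rw [heq, sub_zero]
      _ ≤ ∫ y in Set.Iic x, ‖2 * (u y * deriv u y)‖ :=
        integral_mono hi.integrableOn hi.norm.integrableOn fun y => le_abs_self _
      _ ≤ K := setIntegral_le_integral hi.norm (.of_forall fun y => norm_nonneg _)
  refine abs_le_of_sq_le_sq (by nlinarith) (by linarith)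

lemma integrable_rpow (h : InH1mass μ u) {r : ℝ} (hr : 2 ≤ r) :
    Integrable fun x => |u x| ^ r := by
  obtain ⟨B, hB, hu⟩ := h.exists_abs_le
  refine (h.2.1.const_mul (B ^ (r - 2))).mono'
    (h.1.continuous.abs.rpow_const fun x => Or.inr (by linarith)).aestronglyMeasurable
    (.of_forall fun x => ?_)
  have h0 := abs_nonneg (u x)
  rw [Real.norm_of_nonneg (Real.rpow_nonneg h0 r)]
  calc |u x| ^ r = |u x| ^ (r - 2) * |u x| ^ (2 : ℝ) := by
        rw [← Real.rpow_add_of_nonneg h0 (by linarith) (by norm_num)]; congr 1; ring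
    _ ≤ B ^ (r - 2) * u x ^ 2 := by
        rw [Real.rpow_two, sq_abs]
        gcongr
        exact hu x

lemma integrable_pow_six (h : InH1mass μ u) : Integrable fun x => u x ^ 6 := by
  refine (h.integrable_rpow (r := 6) (by norm_num)).congr (.of_forall fun x => ?_)
  have : |u x| ^ (6 : ℝ) = |u x| ^ 6 := by exact_mod_cast Real.rpow_natCast |u x| 6
  simp only [this]
  exact Even.pow_abs (by decide) _

/-- The Gagliardo-Nirenberg inequality for a non-optimal constant `k`, by calibration with the
field `u' = -k u³ tan (2 k s)`, where `s` is the centred mass coordinate. -/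
lemma sq_mul_integral_pow_six_le_of_lt (h : InH1mass μ u) {k : ℝ} (hk : 0 ≤ k)
    (hkμ : k * μ < Real.pi / 2) :
    k ^ 2 * ∫ x, u x ^ 6 ≤ ∫ x, deriv u x ^ 2 := by
  obtain ⟨B, hB, hu⟩ := h.exists_abs_le
  have hc : Continuous fun x => u x ^ 2 := h.1.continuous.pow 2
  set s : ℝ → ℝ := fun x => ∫ y in Set.Iic x, u y ^ 2
  have hs0 : ∀ x, 0 ≤ s x := fun x => integral_nonneg fun y => sq_nonneg _
  have hsμ : ∀ x, s x ≤ μ := fun x => h.2.2.2 ▸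
    setIntegral_le_integral h.2.1 (.of_forall fun y => sq_nonneg _)
  have hsd : ∀ x, HasDerivAt s (u x ^ 2) x := fun x => by
    have heq : s = fun x => s 0 + ∫ y in (0 : ℝ)..x, u y ^ 2 := by
      funext x
      have := intervalIntegral.integral_Iic_sub_Iic (a := 0) (b := x)
        h.2.1.integrableOn h.2.1.integrableOn
      simp only [s]; linarith
    rw [heq]
    exact (hc.integral_hasStrictDerivAt 0 x).hasDerivAt.const_add _
  have hμ : 0 ≤ μ := (hs0 0).trans (hsμ 0)
  set a : ℝ → ℝ := fun x => k * (2 * s x - μ)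
  have ha : ∀ x, |a x| ≤ k * μ := fun x => by
    simp only [a]
    rw [abs_mul, abs_of_nonneg hk]
    gcongr
    rw [abs_le]; constructor <;> linarith [hs0 x, hsμ x]
  have hkμ0 : 0 ≤ k * μ := by positivity
  have hcos : ∀ x, 0 < Real.cos (a x) := fun x => by
    have := abs_le.1 (ha x)
    exact Real.cos_pos_of_mem_Ioo ⟨by linarith, by linarith⟩
  set T : ℝ → ℝ := fun x => Real.tan (a x)
  have hTb : ∀ x, |T x| ≤ Real.tan (k * μ) := fun x => by
    have hax := abs_le.1 (ha x)
    have hmono := Real.strictMonoOn_tan.monotoneOn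
    rw [abs_le, ← Real.tan_neg]
    exact ⟨hmono ⟨by linarith, by linarith⟩ ⟨by linarith, by linarith⟩ hax.1,
      hmono ⟨by linarith, by linarith⟩ ⟨by linarith, by linarith⟩ hax.2⟩
  have hTd : ∀ x, HasDerivAt T ((1 + T x ^ 2) * (2 * k * u x ^ 2)) x := fun x => by
    have had : HasDerivAt a (2 * k * u x ^ 2) x :=
      ((((hsd x).const_mul 2).sub_const μ).const_mul k).congr_deriv (by ring)
    refine ((Real.hasDerivAt_tan (hcos x).ne').comp x had).congr_deriv ?_
    simp only [T, Real.tan_eq_sin_div_cos]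
    have := (hcos x).ne'
    field_simp
    rw [Real.cos_sq_add_sin_sq, mul_one]
  have hTc : Continuous T := continuous_iff_continuousAt.2 fun x => (hTd x).continuousAt
  have hT2 : ∀ x, T x ^ 2 ≤ Real.tan (k * μ) ^ 2 := fun x =>
    sq_le_sq' (abs_le.1 (hTb x)).1 (abs_le.1 (hTb x)).2
  have hi1 : Integrable fun x => T x * u x ^ 2 * (u x * deriv u x) := by
    refine h.integrable_mul_deriv_s13.bdd_mul (c := Real.tan (k * μ) * B ^ 2)
      (hTc.mul hc).aestronglyMeasurable (.of_forall fun x => ?_)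
    rw [norm_mul, norm_pow, Real.norm_eq_abs, Real.norm_eq_abs]
    have := (abs_nonneg _).trans (hTb x)
    gcongr
    · exact hTb x
    · exact hu x
  have hi2 : Integrable fun x => T x ^ 2 * u x ^ 6 := by
    refine h.integrable_pow_six.bdd_mul (c := Real.tan (k * μ) ^ 2)
      (hTc.pow 2).aestronglyMeasurable (.of_forall fun x => ?_)
    rw [Real.norm_of_nonneg (sq_nonneg _)]
    exact hT2 x
  have hi3 : Integrable fun x => T x * u x ^ 2 * u x ^ 2 := by
    refine h.2.1.bdd_mul (c := Real.tan (k * μ) * B ^ 2)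
      (hTc.mul hc).aestronglyMeasurable (.of_forall fun x => ?_)
    rw [norm_mul, norm_pow, Real.norm_eq_abs, Real.norm_eq_abs]
    have := (abs_nonneg _).trans (hTb x)
    gcongr
    · exact hTb x
    · exact hu x
  have hF : ∀ x, HasDerivAt (fun x => T x * u x ^ 2 * u x ^ 2)
      (4 * (T x * u x ^ 2 * (u x * deriv u x)) + 2 * k * (u x ^ 6 + T x ^ 2 * u x ^ 6)) x :=
    fun x => by
      have hu2 : HasDerivAt (fun y => u y ^ 2) (2 * (u x * deriv u x)) x :=
        ((h.1 x).hasDerivAt.fun_pow 2).congr_deriv (by push_cast; ring)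
      exact (((hTd x).fun_mul hu2).fun_mul hu2).congr_deriv (by ring)
  have hi4 : Integrable fun x =>
      4 * (T x * u x ^ 2 * (u x * deriv u x)) + 2 * k * (u x ^ 6 + T x ^ 2 * u x ^ 6) :=
    (hi1.const_mul 4).add ((h.integrable_pow_six.add hi2).const_mul (2 * k))
  have hzero := integral_eq_zero_of_hasDerivAt_of_integrable hF hi4 hi3
  have hsq : 0 ≤ ∫ x, ((deriv u x ^ 2 - k ^ 2 * u x ^ 6) + k / 2 *
      (4 * (T x * u x ^ 2 * (u x * deriv u x)) + 2 * k * (u x ^ 6 + T x ^ 2 * u x ^ 6))) := by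
    refine integral_nonneg fun x => ?_
    have : 0 ≤ (deriv u x + k * u x ^ 3 * T x) ^ 2 := sq_nonneg _
    simp only [Pi.zero_apply]
    nlinarith
  have hi5 := h.integrable_pow_six.const_mul (k ^ 2)
  have hi6 : Integrable fun x => deriv u x ^ 2 - k ^ 2 * u x ^ 6 := h.2.2.1.sub hi5
  rw [integral_add hi6 (hi4.const_mul (k / 2)), integral_const_mul (k / 2), hzero,
    integral_sub h.2.2.1 hi5, integral_const_mul] at hsq
  linarith

/-- The sharp one-dimensional Gagliardo-Nirenberg inequality for the critical exponent. -/
lemma integral_pow_six_le (h : InH1mass μ u) (hμ : 0 < μ) :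
    (Real.pi / (2 * μ)) ^ 2 * ∫ x, u x ^ 6 ≤ ∫ x, deriv u x ^ 2 := by
  have hK : 0 < Real.pi / (2 * μ) := by positivity
  refine ContinuousWithinAt.closure_le (s := Set.Ioo 0 (Real.pi / (2 * μ)))
    (f := fun k => k ^ 2 * ∫ x, u x ^ 6) (g := fun _ => ∫ x, deriv u x ^ 2) ?_ ?_ ?_ ?_
  · rw [closure_Ioo hK.ne]; exact ⟨hK.le, le_rfl⟩
  · exact (by fun_prop : Continuous fun k : ℝ => k ^ 2 * ∫ x, u x ^ 6).continuousWithinAt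
  · exact continuousWithinAt_const
  · rintro k ⟨hk0, hk⟩
    refine h.sq_mul_integral_pow_six_le_of_lt hk0.le ?_
    rw [lt_div_iff₀ (by positivity)] at hk
    linarith

lemma integrable_energy (h : InH1mass μ u) {p q : ℝ} (hp : 2 ≤ p) (hq : 2 ≤ q) (α : ℝ) :
    Integrable fun x =>
      (1 / 2) * (deriv u x) ^ 2 - (1 / p) * |u x| ^ p - (α / q) * |u x| ^ q :=
  ((h.2.2.1.const_mul _).sub ((h.integrable_rpow hp).const_mul _)).sub
    ((h.integrable_rpow hq).const_mul _)

lemma sqrt_mul (h : InH1mass μ u) {θ : ℝ} (hθ : 0 ≤ θ) :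
    InH1mass (θ * μ) fun x => √θ * u x := by
  obtain ⟨hd, h1, h2, h3⟩ := h
  refine ⟨hd.const_mul _, ?_, ?_, ?_⟩
  · simpa only [mul_pow] using h1.const_mul (√θ ^ 2)
  · simpa only [deriv_const_mul_field, mul_pow] using h2.const_mul (√θ ^ 2)
  · simp only [mul_pow, integral_const_mul, h3, Real.sq_sqrt hθ]

end InH1mass

lemma exists_inH1mass {μ : ℝ} (hμ : 0 ≤ μ) : ∃ u, InH1mass μ u := by
  let v : ℝ → ℝ := fun x => Real.exp (-x ^ 2)
  have hd : ∀ x, HasDerivAt v (-2 * x * v x) x := fun x => by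
    refine ((hasDerivAt_id' x).fun_pow 2).fun_neg.exp.congr_deriv ?_
    simp only [v]; push_cast; ring
  have hsq : (fun x => v x ^ 2) = fun x => Real.exp (-2 * x ^ 2) := by
    funext x
    simp only [v, ← Real.exp_nat_mul]; congr 1; push_cast; ring
  have hv : InH1mass (√(Real.pi / 2)) v := by
    refine ⟨fun x => (hd x).differentiableAt, ?_, ?_, ?_⟩
    · rw [hsq]; exact integrable_exp_neg_mul_sq two_pos
    · have := (integrable_rpow_mul_exp_neg_mul_sq two_pos
        (by norm_num : (-1 : ℝ) < 2)).const_mul 4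
      refine this.congr (.of_forall fun x => ?_)
      have hx : v x ^ 2 = Real.exp (-2 * x ^ 2) := congrFun hsq x
      simp only [(hd x).deriv, Real.rpow_two, mul_pow, hx]
      ring
    · rw [hsq]; exact integral_gaussian 2
  have hpos : 0 < √(Real.pi / 2) := Real.sqrt_pos.2 (by positivity)
  have := hv.sqrt_mul (θ := μ / √(Real.pi / 2)) (by positivity)
  rw [div_mul_cancel₀ _ hpos.ne'] at this
  exact ⟨_, this⟩

lemma exists_rpow_le_mul_pow_six_add {p ε : ℝ} (hp2 : 2 ≤ p) (hp6 : p < 6) (hε : 0 < ε) :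
    ∃ C, ∀ t : ℝ, |t| ^ p ≤ ε * t ^ 6 + C * t ^ 2 := by
  have hlim := tendsto_rpow_neg_atTop (show 0 < 6 - p by linarith)
  obtain ⟨M, hM, hM0⟩ := ((hlim.eventually_lt_const hε).and
    (Filter.eventually_gt_atTop 0)).exists
  refine ⟨M ^ (p - 2), fun t => ?_⟩
  have h0 := abs_nonneg t
  have ht2 : |t| ^ (2 : ℝ) = t ^ 2 := by rw [Real.rpow_two, sq_abs]
  have ht6 : |t| ^ (6 : ℝ) = t ^ 6 := by
    have : |t| ^ (6 : ℝ) = |t| ^ 6 := by exact_mod_cast Real.rpow_natCast |t| 6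
    rw [this]; exact Even.pow_abs (by decide) _
  have hn2 : 0 ≤ t ^ 2 := sq_nonneg t
  have hn6 : 0 ≤ t ^ 6 := by positivity
  rcases le_total |t| M with hle | hle
  · have : |t| ^ p ≤ M ^ (p - 2) * t ^ 2 := by
      rw [show p = (p - 2) + 2 by ring, Real.rpow_add_of_nonneg h0 (by linarith) (by norm_num),
        ht2, add_sub_cancel_right]
      gcongr
    nlinarith [mul_nonneg hε.le hn6]
  · have ht : 0 < |t| := hM0.trans_le hle
    have : |t| ^ p ≤ ε * t ^ 6 := by
      rw [show p = -(6 - p) + 6 by ring, Real.rpow_add ht, ht6]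
      refine mul_le_mul_of_nonneg_right (le_trans ?_ hM.le) hn6
      exact Real.rpow_le_rpow_of_nonpos hM0 hle (by linarith)
    nlinarith [mul_nonneg (Real.rpow_nonneg hM0.le (p - 2)) hn2]

lemma exists_le_NLSenergy_of_rpow_le {p q α μ ε C : ℝ} (hq : 2 < q) (hqp : q < p) (hα : α < 0)
    (hμ : 0 < μ) (hC : ∀ t : ℝ, |t| ^ p ≤ ε * t ^ 6 + C * t ^ 2)
    (hε : ε ≤ p / 2 * (Real.pi / (2 * μ)) ^ 2) :
    ∃ L, ∀ u, InH1mass μ u → L ≤ NLSenergy p q α u := by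
  have hp : 0 < p := by linarith
  refine ⟨-(C / p * μ), fun u h => ?_⟩
  have hi6 := h.integrable_pow_six
  have hgn := h.integral_pow_six_le hμ
  have h6 : 0 ≤ ∫ x, u x ^ 6 := integral_nonneg fun x => by positivity
  have hi' : Integrable fun x => 1 / 2 * deriv u x ^ 2 - ε / p * u x ^ 6 :=
    (h.2.2.1.const_mul (1 / 2)).sub (hi6.const_mul (ε / p))
  have hmono : ∫ x, (1 / 2 * deriv u x ^ 2 - ε / p * u x ^ 6 - C / p * u x ^ 2) ≤
      NLSenergy p q α u := by
    refine integral_mono (hi'.sub (h.2.1.const_mul (C / p)))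
      (h.integrable_energy (by linarith) hq.le α) fun x => ?_
    have h1 : 1 / p * |u x| ^ p ≤ 1 / p * (ε * u x ^ 6 + C * u x ^ 2) := by
      gcongr; exact hC _
    have h2 : α / q * |u x| ^ q ≤ 0 :=
      mul_nonpos_of_nonpos_of_nonneg (div_nonpos_of_nonpos_of_nonneg hα.le (by linarith))
        (by positivity)
    have h3 : 1 / p * (ε * u x ^ 6 + C * u x ^ 2) = ε / p * u x ^ 6 + C / p * u x ^ 2 := by ring
    simp only
    linarith
  rw [integral_sub hi' (h.2.1.const_mul (C / p)),
    integral_sub (h.2.2.1.const_mul (1 / 2)) (hi6.const_mul (ε / p)),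
    integral_const_mul, integral_const_mul, integral_const_mul, h.2.2.2] at hmono
  have h4 : ε / p ≤ 1 / 2 * (Real.pi / (2 * μ)) ^ 2 := by
    rw [div_le_iff₀ hp]; linarith
  have := mul_le_mul_of_nonneg_right h4 h6
  linarith

lemma exists_le_NLSenergy {p q α μ : ℝ} (hq : 2 < q) (hqp : q < p) (hp : p ≤ 6) (hα : α < 0)
    (hμ : 0 < μ) (hcrit : p = 6 → μ ≤ muR) :
    ∃ L, ∀ u, InH1mass μ u → L ≤ NLSenergy p q α u := by
  have hp0 : 0 < p := by linarith
  rcases hp.lt_or_eq with hlt | heq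
  · obtain ⟨C, hC⟩ := exists_rpow_le_mul_pow_six_add (p := p)
      (ε := p / 2 * (Real.pi / (2 * μ)) ^ 2) (by linarith) hlt (by positivity)
    exact exists_le_NLSenergy_of_rpow_le hq hqp hα hμ hC le_rfl
  · refine exists_le_NLSenergy_of_rpow_le (ε := 1) (C := 0) hq hqp hα hμ (fun t => ?_) ?_
    · have : |t| ^ (6 : ℝ) = |t| ^ 6 := by exact_mod_cast Real.rpow_natCast |t| 6
      rw [heq, this, Even.pow_abs (by decide)]
      linarith
    · have h1 : μ ^ 2 ≤ muR ^ 2 := pow_le_pow_left₀ hμ.le (hcrit heq) 2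
      have h2 : muR ^ 2 = 3 / 4 * Real.pi ^ 2 := by
        rw [muR, mul_pow, div_pow, Real.sq_sqrt (by norm_num)]; norm_num
      rw [heq, div_pow, ← mul_div_assoc, le_div_iff₀ (by positivity)]
      linarith

lemma exists_groundLevel_eq {p q α μ : ℝ} (hμ : 0 ≤ μ)
    (hbdd : ∃ L, ∀ u, InH1mass μ u → L ≤ NLSenergy p q α u) :
    ∃ a : ℝ, groundLevel p q α μ = a ∧ IsGLB (NLSenergy p q α '' {u | InH1mass μ u}) a := by
  obtain ⟨L, hL⟩ := hbdd
  obtain ⟨v, hv⟩ := exists_inH1mass hμ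
  have hlow : ∀ K : ℝ, (∀ u, InH1mass μ u → K ≤ NLSenergy p q α u) →
      (K : EReal) ≤ groundLevel p q α μ := fun K hK => le_sInf <| by
    rintro _ ⟨u, hu, rfl⟩
    exact EReal.coe_le_coe_iff.2 (hK u hu)
  have hup : ∀ u, InH1mass μ u → groundLevel p q α μ ≤ (NLSenergy p q α u : EReal) :=
    fun u hu => sInf_le ⟨u, hu, rfl⟩
  have heq : groundLevel p q α μ = ((groundLevel p q α μ).toReal : EReal) :=
    (EReal.coe_toReal ((hup v hv).trans_lt (EReal.coe_lt_top _)).ne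
      ((EReal.bot_lt_coe L).trans_le (hlow L hL)).ne').symm
  refine ⟨_, heq, ?_, fun K hK => ?_⟩
  · rintro _ ⟨u, hu, rfl⟩
    exact EReal.coe_le_coe_iff.1 (heq ▸ hup u hu)
  · exact EReal.coe_le_coe_iff.1 (heq ▸ hlow K fun u hu => hK ⟨u, hu, rfl⟩)

lemma NLSenergy_sqrt_mul_le {p q α μ θ : ℝ} {u : ℝ → ℝ} (hq : 2 ≤ q) (hqp : q ≤ p) (hα : α ≤ 0)
    (hθ : 1 ≤ θ) (h : InH1mass μ u) :
    NLSenergy p q α (fun x => √θ * u x) ≤ θ ^ (p / 2) * NLSenergy p q α u := by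
  have hθ0 : 0 ≤ θ := by linarith
  have hpow : ∀ (r y : ℝ), |√θ * y| ^ r = θ ^ (r / 2) * |y| ^ r := fun r y => by
    rw [abs_mul, abs_of_nonneg (Real.sqrt_nonneg θ),
      Real.mul_rpow (Real.sqrt_nonneg θ) (abs_nonneg y), Real.sqrt_eq_rpow, ← Real.rpow_mul hθ0]
    congr 2; ring
  rw [NLSenergy, NLSenergy, ← integral_const_mul]
  refine integral_mono ((h.sqrt_mul hθ0).integrable_energy (hq.trans hqp) hq α)
    ((h.integrable_energy (hq.trans hqp) hq α).const_mul _) fun x => ?_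
  simp only [deriv_const_mul_field, hpow, mul_pow, Real.sq_sqrt hθ0]
  have h1 : θ ≤ θ ^ (p / 2) := by
    simpa using Real.rpow_le_rpow_of_exponent_le hθ (show (1 : ℝ) ≤ p / 2 by linarith)
  have h2 : θ ^ (q / 2) ≤ θ ^ (p / 2) := Real.rpow_le_rpow_of_exponent_le hθ (by linarith)
  have h3 : 0 ≤ -(α / q) * |u x| ^ q :=
    mul_nonneg (neg_nonneg.2 (div_nonpos_of_nonpos_of_nonneg hα (by linarith))) (by positivity)
  have h4 := mul_le_mul_of_nonneg_right h1 (sq_nonneg (deriv u x))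
  have h5 := mul_le_mul_of_nonneg_right h2 h3
  linarith

/-- scaling inequality 𝓔(θν) ≤ θ^{p/2} 𝓔(ν), both levels finite. -/
theorem scaling_inequality_levels
    (p q α ν θ : ℝ) (hq : 2 < q) (hqp : q < p) (hp : p ≤ 6) (hα : α < 0)
    (hν : 0 < ν) (hθ : 1 ≤ θ) (hcrit : p = 6 → θ * ν ≤ muR) :
    ∃ a b : ℝ, groundLevel p q α ν = (a : EReal) ∧
      groundLevel p q α (θ * ν) = (b : EReal) ∧
      b ≤ θ ^ (p / 2) * a := by
  have hle : ν ≤ θ * ν := le_mul_of_one_le_left hν.le hθ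
  obtain ⟨a, ha, -, ha'⟩ := exists_groundLevel_eq hν.le
    (exists_le_NLSenergy hq hqp hp hα hν fun h => hle.trans (hcrit h))
  obtain ⟨b, hb, hb', -⟩ := exists_groundLevel_eq (hν.le.trans hle)
    (exists_le_NLSenergy hq hqp hp hα (hν.trans_le hle) hcrit)
  refine ⟨a, b, ha, hb, ?_⟩
  have hpos : 0 < θ ^ (p / 2) := Real.rpow_pos_of_pos (by linarith) _
  rw [← div_le_iff₀' hpos]
  refine ha' ?_
  rintro _ ⟨u, hu, rfl⟩
  rw [div_le_iff₀' hpos]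
  exact (hb' ⟨_, InH1mass.sqrt_mul hu (by linarith), rfl⟩).trans
    (NLSenergy_sqrt_mul_le hq.le hqp.le hα.le hθ hu)
end

section
/- Let 2 < q < p < 6, α < 0 and μ > 0, and suppose 𝓔_{p,q,α}(μ) < 0. Then for all μ₁, μ₂ > 0 with μ₁ + μ₂ = μ, the strict subadditivity inequality 𝓔_{p,q,α}(μ) < 𝓔_{p,q,α}(μ₁) + 𝓔_{p,q,α}(μ₂) holds. -/
open MeasureTheory

/-- Agmon-type inequality: an `H¹` function on the line is bounded in terms of its mass and its
kinetic energy. -/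
lemma InH1mass.sq_le {μ : ℝ} {u : ℝ → ℝ} (h : InH1mass μ u) {ε : ℝ} (hε : 0 < ε) (x : ℝ) :
    u x ^ 2 ≤ ε * (∫ y, deriv u y ^ 2) + ε⁻¹ * μ := by
  obtain ⟨hd, hu, hu', rfl⟩ := h
  have hdom : Integrable fun y => ε * deriv u y ^ 2 + ε⁻¹ * u y ^ 2 :=
    (hu'.const_mul ε).add (hu.const_mul ε⁻¹)
  have hbound : ∀ y, |2 * u y * deriv u y| ≤ ε * deriv u y ^ 2 + ε⁻¹ * u y ^ 2 := by
    intro y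
    have h1 : ε⁻¹ * (ε * deriv u y - u y) ^ 2 =
        ε * deriv u y ^ 2 + ε⁻¹ * u y ^ 2 - 2 * u y * deriv u y := by
      field_simp
      ring
    have h2 : ε⁻¹ * (ε * deriv u y + u y) ^ 2 =
        ε * deriv u y ^ 2 + ε⁻¹ * u y ^ 2 + 2 * u y * deriv u y := by
      field_simp
      ring
    have h3 : 0 ≤ ε⁻¹ * (ε * deriv u y - u y) ^ 2 := by positivity
    have h4 : 0 ≤ ε⁻¹ * (ε * deriv u y + u y) ^ 2 := by positivity
    rw [abs_le]
    constructor <;> linarith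
  have hderiv : ∀ y, HasDerivAt (fun z => u z ^ 2) (2 * u y * deriv u y) y := by
    intro y
    simpa using (hd y).hasDerivAt.fun_pow 2
  have hint : Integrable fun y => 2 * u y * deriv u y := by
    refine hdom.mono' ?_ (.of_forall hbound)
    exact ((hd.continuous.measurable.const_mul 2).mul (measurable_deriv u)).aestronglyMeasurable
  have hlim : Filter.Tendsto (fun z => u z ^ 2) Filter.atBot (nhds 0) :=
    tendsto_zero_of_hasDerivAt_of_integrableOn_Iic (a := x) (fun y _ => hderiv y)
      hint.integrableOn hu.integrableOn
  have hftc : ∫ y in Set.Iic x, 2 * u y * deriv u y = u x ^ 2 - 0 :=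
    integral_Iic_of_hasDerivAt_of_tendsto' (fun y _ => hderiv y) hint.integrableOn hlim
  calc u x ^ 2 = ∫ y in Set.Iic x, 2 * u y * deriv u y := by rw [hftc, sub_zero]
    _ ≤ ∫ y in Set.Iic x, (ε * deriv u y ^ 2 + ε⁻¹ * u y ^ 2) :=
        integral_mono hint.integrableOn hdom.integrableOn fun y => (le_abs_self _).trans (hbound y)
    _ ≤ ∫ y, (ε * deriv u y ^ 2 + ε⁻¹ * u y ^ 2) :=
        setIntegral_le_integral hdom (.of_forall fun y => (abs_nonneg _).trans (hbound y))
    _ = _ := by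
        rw [integral_add (hu'.const_mul ε) (hu.const_mul ε⁻¹), integral_const_mul,
          integral_const_mul]

lemma abs_rpow_le_of_sq_le {s y B : ℝ} (hs : 2 ≤ s) (h : y ^ 2 ≤ B) :
    |y| ^ s ≤ B ^ ((s - 2) / 2) * y ^ 2 := by
  have h1 : |y| ^ s = (y ^ 2) ^ ((s - 2) / 2) * y ^ 2 := by
    rcases eq_or_ne y 0 with rfl | hy
    · simp [Real.zero_rpow (by linarith : s ≠ 0)]
    · rw [← sq_abs y, ← Real.rpow_natCast, ← Real.rpow_mul (abs_nonneg y),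
        ← Real.rpow_add (abs_pos.mpr hy)]
      congr 1
      push_cast
      ring
  rw [h1]
  gcongr

lemma InH1mass.integrable_abs_rpow {μ : ℝ} {u : ℝ → ℝ} (h : InH1mass μ u) {s : ℝ} (hs : 2 ≤ s) :
    Integrable fun x => |u x| ^ s := by
  refine (h.2.1.const_mul ((1 * (∫ y, deriv u y ^ 2) + 1⁻¹ * μ) ^ ((s - 2) / 2))).mono' ?_
    (.of_forall fun x => ?_)
  · exact (h.1.continuous.abs.rpow_const fun x => Or.inr (by linarith)).aestronglyMeasurable
  · rw [Real.norm_of_nonneg (by positivity)]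
    exact abs_rpow_le_of_sq_le hs (h.sq_le one_pos x)

lemma InH1mass.energy_eq {μ : ℝ} {u : ℝ → ℝ} (h : InH1mass μ u) {p q : ℝ} (α : ℝ)
    (hp : 2 ≤ p) (hq : 2 ≤ q) :
    NLSenergy p q α u = (1 / 2) * (∫ x, deriv u x ^ 2) - (1 / p) * (∫ x, |u x| ^ p) -
      (α / q) * ∫ x, |u x| ^ q := by
  have h1 := h.2.2.1.const_mul (1 / 2)
  have h2 := (h.integrable_abs_rpow hp).const_mul (1 / p)
  have h3 := (h.integrable_abs_rpow hq).const_mul (α / q)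
  unfold NLSenergy
  rw [integral_sub (by exact h1.sub h2) h3, integral_sub h1 h2, integral_const_mul, integral_const_mul,
    integral_const_mul]

/-- Gagliardo–Nirenberg inequality, with a non-sharp constant. -/
lemma InH1mass.integral_abs_rpow_le {μ : ℝ} {u : ℝ → ℝ} (h : InH1mass μ u) {s : ℝ} (hs : 2 ≤ s) :
    ∫ x, |u x| ^ s ≤
      (1 + μ) ^ ((s - 2) / 2) * μ * ((∫ x, deriv u x ^ 2) + 1) ^ ((s - 2) / 4) := by
  have hμ : 0 ≤ μ := h.2.2.2 ▸ integral_nonneg fun x => sq_nonneg (u x)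
  set T := ∫ x, deriv u x ^ 2 with hT
  have hT0 : 0 ≤ T := integral_nonneg fun x => sq_nonneg (deriv u x)
  have hr : 0 < √(T + 1) := Real.sqrt_pos.mpr (by linarith)
  have hB : ∀ x, u x ^ 2 ≤ (1 + μ) * √(T + 1) := by
    intro x
    have h1 := h.sq_le (inv_pos.mpr hr) x
    rw [inv_inv, ← hT] at h1
    have h2 : (√(T + 1))⁻¹ * T ≤ √(T + 1) := by
      rw [inv_mul_le_iff₀ hr, Real.mul_self_sqrt (by linarith)]
      linarith
    linarith
  calc ∫ x, |u x| ^ s ≤ ∫ x, ((1 + μ) * √(T + 1)) ^ ((s - 2) / 2) * u x ^ 2 :=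
        integral_mono (h.integrable_abs_rpow hs) (h.2.1.const_mul _)
          fun x => abs_rpow_le_of_sq_le hs (hB x)
    _ = (1 + μ) ^ ((s - 2) / 2) * μ * (T + 1) ^ ((s - 2) / 4) := by
        rw [integral_const_mul, h.2.2.2, Real.mul_rpow (by linarith) hr.le, Real.sqrt_eq_rpow,
          ← Real.rpow_mul (by linarith)]
        ring_nf

lemma mul_rpow_le_half_add {C r s : ℝ} (hC : 0 ≤ C) (hr0 : 0 ≤ r) (hr1 : r < 1) (hs : 0 < s) :
    C * s ^ r ≤ s / 2 + C * ((2 * C) ^ (1 - r)⁻¹) ^ r := by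
  have hK : 0 ≤ (2 * C) ^ (1 - r)⁻¹ := by positivity
  rcases le_total ((2 * C) ^ (1 - r)⁻¹) s with h | h
  · have h1 : 2 * C ≤ s ^ (1 - r) := by
      have := Real.rpow_le_rpow hK h (by linarith : 0 ≤ 1 - r)
      rwa [Real.rpow_inv_rpow (by positivity) (by linarith)] at this
    have h2 : s ^ (1 - r) * s ^ r = s := by
      rw [← Real.rpow_add hs, sub_add_cancel, Real.rpow_one]
    have h3 : 2 * C * s ^ r ≤ s ^ (1 - r) * s ^ r := by gcongr
    have h4 : 0 ≤ C * ((2 * C) ^ (1 - r)⁻¹) ^ r := by positivity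
    linarith
  · have : C * s ^ r ≤ C * ((2 * C) ^ (1 - r)⁻¹) ^ r := by gcongr
    linarith

/-- In the defocusing subcritical case the ground-state level is not `-∞`. -/
lemma groundLevel_ne_bot {p q α : ℝ} (μ : ℝ) (hq : 2 ≤ q) (hp2 : 2 ≤ p) (hp : p < 6)
    (hα : α ≤ 0) : groundLevel p q α μ ≠ ⊥ := by
  set C := (1 / p) * ((1 + μ) ^ ((p - 2) / 2) * μ) with hC
  set K := C * ((2 * C) ^ (1 - (p - 2) / 4)⁻¹) ^ ((p - 2) / 4) with hK
  have hle : (((-(1 / 2) - K : ℝ)) : EReal) ≤ groundLevel p q α μ := by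
    refine le_sInf ?_
    rintro _ ⟨u, hu, rfl⟩
    rw [Set.mem_ofPred_eq] at hu
    rw [EReal.coe_le_coe_iff, hu.energy_eq α hp2 hq]
    have hμ : 0 ≤ μ := hu.2.2.2 ▸ integral_nonneg fun x => sq_nonneg (u x)
    have hT0 : 0 ≤ ∫ x, deriv u x ^ 2 := integral_nonneg fun x => sq_nonneg (deriv u x)
    have hQ : 0 ≤ ∫ x, |u x| ^ q := integral_nonneg fun x => by positivity
    have hαq : α / q * ∫ x, |u x| ^ q ≤ 0 :=
      mul_nonpos_of_nonpos_of_nonneg (div_nonpos_of_nonpos_of_nonneg hα (by linarith)) hQ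
    have h1 := mul_le_mul_of_nonneg_left (hu.integral_abs_rpow_le hp2)
      (by positivity : 0 ≤ 1 / p)
    have h2 := mul_rpow_le_half_add (C := C) (r := (p - 2) / 4)
      (s := (∫ x, deriv u x ^ 2) + 1) (by positivity) (by linarith) (by linarith) (by linarith)
    rw [← mul_assoc, ← hC] at h1
    linarith
  intro h
  rw [h] at hle
  exact EReal.coe_ne_bot _ (le_bot_iff.mp hle)

lemma InH1mass.const_mul_sqrt {μ : ℝ} {u : ℝ → ℝ} (h : InH1mass μ u) {θ : ℝ} (hθ : 0 ≤ θ) :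
    InH1mass (θ * μ) fun x => √θ * u x := by
  obtain ⟨hd, hu, hu', hμ⟩ := h
  refine ⟨hd.const_mul _, ?_, ?_, ?_⟩
  · simpa only [mul_pow, Real.sq_sqrt hθ] using hu.const_mul θ
  · simpa only [deriv_const_mul_field', mul_pow, Real.sq_sqrt hθ] using hu'.const_mul θ
  · simp only [mul_pow, Real.sq_sqrt hθ, integral_const_mul, hμ]

lemma integral_abs_sqrt_mul_rpow (u : ℝ → ℝ) {θ : ℝ} (hθ : 0 < θ) (s : ℝ) :
    ∫ x, |√θ * u x| ^ s = θ * θ ^ (s / 2 - 1) * ∫ x, |u x| ^ s := by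
  have : ∀ x, |√θ * u x| ^ s = θ * θ ^ (s / 2 - 1) * |u x| ^ s := by
    intro x
    rw [abs_mul, Real.mul_rpow (abs_nonneg _) (abs_nonneg _), abs_of_nonneg (Real.sqrt_nonneg θ),
      Real.sqrt_eq_rpow, ← Real.rpow_mul hθ.le]
    congr 1
    nth_rewrite 2 [← Real.rpow_one θ]
    rw [← Real.rpow_add hθ]
    ring_nf
  simp_rw [this, integral_const_mul]

/-- Increasing the mass by scaling the amplitude lowers a nonpositive energy superlinearly. -/
lemma InH1mass.energy_sqrt_mul_le {p q α μ : ℝ} (hq : 2 ≤ q) (hqp : q ≤ p) (hα : α ≤ 0)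
    {u : ℝ → ℝ} (h : InH1mass μ u) (hE : NLSenergy p q α u ≤ 0) {θ : ℝ} (hθ : 1 ≤ θ) :
    NLSenergy p q α (fun x => √θ * u x) ≤
      θ * (1 + (θ ^ (p / 2 - 1) - θ ^ (q / 2 - 1))) * NLSenergy p q α u := by
  have hθ0 : 0 < θ := by linarith
  have hp : 2 ≤ p := hq.trans hqp
  have hT : ∫ x, deriv (fun x => √θ * u x) x ^ 2 = θ * ∫ x, deriv u x ^ 2 := by
    simp only [deriv_const_mul_field', mul_pow, Real.sq_sqrt hθ0.le, integral_const_mul]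
  rw [h.energy_eq α hp hq] at hE ⊢
  rw [(h.const_mul_sqrt hθ0.le).energy_eq α hp hq, hT, integral_abs_sqrt_mul_rpow u hθ0,
    integral_abs_sqrt_mul_rpow u hθ0]
  have hT0 : 0 ≤ ∫ x, deriv u x ^ 2 := integral_nonneg fun x => sq_nonneg (deriv u x)
  have hQ : 0 ≤ ∫ x, |u x| ^ q := integral_nonneg fun x => by positivity
  have hαq : α / q * ∫ x, |u x| ^ q ≤ 0 :=
    mul_nonpos_of_nonpos_of_nonneg (div_nonpos_of_nonpos_of_nonneg hα (by linarith)) hQ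
  have hb : 1 ≤ θ ^ (q / 2 - 1) := Real.one_le_rpow hθ (by linarith)
  have hab : θ ^ (q / 2 - 1) ≤ θ ^ (p / 2 - 1) :=
    Real.rpow_le_rpow_of_exponent_le hθ (by linarith)
  generalize θ ^ (q / 2 - 1) = b at *
  generalize θ ^ (p / 2 - 1) = a at *
  generalize (∫ x, deriv u x ^ 2) = T at *
  have hA : 1 / p * (θ * a * ∫ x, |u x| ^ p) = θ * (a * (1 / p * ∫ x, |u x| ^ p)) := by ring
  have hB : α / q * (θ * b * ∫ x, |u x| ^ q) = θ * (b * (α / q * ∫ x, |u x| ^ q)) := by ring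
  rw [hA, hB]
  generalize (1 / p * ∫ x, |u x| ^ p) = A at *
  generalize (α / q * ∫ x, |u x| ^ q) = B at *
  have key : 1 / 2 * T - a * A - b * B ≤ (1 + (a - b)) * (1 / 2 * T - A - B) := by
    have h1 : 0 ≤ (b - 1) * (A + B - 1 / 2 * T) := mul_nonneg (by linarith) (by linarith)
    have h2 : 0 ≤ (b - 1) * T := mul_nonneg (by linarith) hT0
    have h3 : 0 ≤ (a - b) * T := mul_nonneg (by linarith) hT0
    have h4 : 0 ≤ (a - b) * -B := mul_nonneg (by linarith) (by linarith)
    linarith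
  have := mul_le_mul_of_nonneg_left key hθ0.le
  linarith

/-- A negative ground-state level is strictly superlinear in the mass. -/
lemma groundLevel_mul_lt {p q α μ r θ : ℝ} (hq : 2 ≤ q) (hqp : q < p) (hα : α ≤ 0)
    (hr : groundLevel p q α μ = r) (hr0 : r < 0) (hθ : 1 < θ) :
    groundLevel p q α (θ * μ) < ((θ * r : ℝ) : EReal) := by
  set c := 1 + (θ ^ (p / 2 - 1) - θ ^ (q / 2 - 1)) with hc
  have hc1 : 1 < c := by
    have := Real.rpow_lt_rpow_of_exponent_lt hθ (by linarith : q / 2 - 1 < p / 2 - 1)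
    linarith
  have hrc : r < r / c := by
    rw [lt_div_iff₀ (by linarith)]
    nlinarith
  have hlt : groundLevel p q α μ < ((r / c : ℝ) : EReal) := by
    rw [hr]
    exact_mod_cast hrc
  obtain ⟨_, ⟨u, hu, rfl⟩, hE⟩ := sInf_lt_iff.mp hlt
  rw [Set.mem_ofPred_eq] at hu
  rw [EReal.coe_lt_coe_iff, lt_div_iff₀ (by linarith)] at hE
  have hE0 : NLSenergy p q α u ≤ 0 := by
    by_contra! h
    nlinarith
  have hle : groundLevel p q α (θ * μ) ≤ (NLSenergy p q α fun x => √θ * u x : ℝ) :=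
    sInf_le ⟨_, hu.const_mul_sqrt (by linarith), rfl⟩
  refine hle.trans_lt ?_
  rw [EReal.coe_lt_coe_iff]
  refine (hu.energy_sqrt_mul_le hq hqp.le hα hE0 hθ.le).trans_lt ?_
  rw [← hc, mul_assoc, mul_comm c]
  exact mul_lt_mul_of_pos_left hE (by linarith)

lemma groundLevel_lt_div_mul {p q α μ₁ μ r : ℝ} (hq : 2 ≤ q) (hqp : q < p) (hα : α ≤ 0)
    (hr : groundLevel p q α μ₁ = r) (hr0 : r < 0) (hμ₁ : 0 < μ₁) (hμ : μ₁ < μ) :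
    groundLevel p q α μ < ((μ / μ₁ * r : ℝ) : EReal) := by
  have := groundLevel_mul_lt hq hqp hα hr hr0 ((one_lt_div hμ₁).mpr hμ)
  rwa [div_mul_cancel₀ _ hμ₁.ne'] at this

/-- A negative ground-state level is strictly decreasing in the mass. -/
lemma groundLevel_strictAnti_of_neg {p q α μ₁ μ : ℝ} (hq : 2 ≤ q) (hqp : q < p) (hp : p < 6)
    (hα : α ≤ 0) (hneg : groundLevel p q α μ₁ < 0) (hμ₁ : 0 < μ₁) (hμ : μ₁ < μ) :
    groundLevel p q α μ < groundLevel p q α μ₁ := by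
  have hr := EReal.coe_toReal hneg.ne_top
    (groundLevel_ne_bot (p := p) μ₁ hq (hq.trans hqp.le) hp hα)
  have hr0 : (groundLevel p q α μ₁).toReal < 0 := by
    rw [← hr] at hneg
    exact_mod_cast hneg
  refine (groundLevel_lt_div_mul hq hqp hα hr.symm hr0 hμ₁ hμ).trans_le ?_
  conv_rhs => rw [← hr]
  rw [EReal.coe_le_coe_iff]
  have := (one_lt_div hμ₁).mpr hμ
  nlinarith

/-- strict subadditivity of the ground-state level in the
defocusing subcritical case. -/
theorem defocusing_strict_subadditivity
    (p q α μ : ℝ) (hq : 2 < q) (hqp : q < p) (hp : p < 6) (hα : α < 0)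
    (hμ : 0 < μ) (hneg : groundLevel p q α μ < 0) :
    ∀ μ₁ μ₂ : ℝ, 0 < μ₁ → 0 < μ₂ → μ₁ + μ₂ = μ →
      groundLevel p q α μ < groundLevel p q α μ₁ + groundLevel p q α μ₂ := by
  intro μ₁ μ₂ h₁ h₂ hsum
  rcases le_or_gt 0 (groundLevel p q α μ₁) with n₁ | n₁
  · rcases le_or_gt 0 (groundLevel p q α μ₂) with n₂ | n₂
    · exact hneg.trans_le (add_nonneg n₁ n₂)
    · exact (groundLevel_strictAnti_of_neg hq.le hqp hp hα.le n₂ h₂ (by linarith)).trans_le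
        (le_add_of_nonneg_left n₁)
  rcases le_or_gt 0 (groundLevel p q α μ₂) with n₂ | n₂
  · exact (groundLevel_strictAnti_of_neg hq.le hqp hp hα.le n₁ h₁ (by linarith)).trans_le
      (le_add_of_nonneg_right n₂)
  have hbot := fun m => groundLevel_ne_bot (p := p) (q := q) (α := α) m hq.le
    (hq.le.trans hqp.le) hp hα.le
  lift groundLevel p q α μ₁ to ℝ using ⟨n₁.ne_top, hbot μ₁⟩ with r₁ hr₁
  lift groundLevel p q α μ₂ to ℝ using ⟨n₂.ne_top, hbot μ₂⟩ with r₂ hr₂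
  have l₁ := groundLevel_lt_div_mul hq.le hqp hα.le hr₁.symm (by exact_mod_cast n₁) h₁
    (by linarith : μ₁ < μ)
  have l₂ := groundLevel_lt_div_mul hq.le hqp hα.le hr₂.symm (by exact_mod_cast n₂) h₂
    (by linarith : μ₂ < μ)
  lift groundLevel p q α μ to ℝ using ⟨hneg.ne_top, hbot μ⟩ with r hr
  rw [EReal.coe_lt_coe_iff, div_mul_eq_mul_div, lt_div_iff₀ (by assumption)] at l₁ l₂
  rw [← EReal.coe_add, EReal.coe_lt_coe_iff]
  refine lt_of_mul_lt_mul_left ?_ hμ.le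
  rw [← hsum] at l₁ l₂ ⊢
  linarith
end
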